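/- arXiv:gr-qc/0002034 — 7 statements merged into one kernel-verified Lean document; each statement's English description precedes it below -/
import Mathlib

section
/- Let 0 < x₀ < x̄ < ∞ and let (f, A, C) solve the mini-boson-star system on [x₀, x̄) with 0 < A(x) < 1 for all x in [x₀, x̄), and suppose there is ε > 0 with A(x) ≥ ε on [x₀, x̄). Then the functions f, f', C and 1/C are all bounded on [x₀, x̄). (Consequently a solution of the system can be continued as long as A stays bounded away from zero.) -/
open Real Set Filter Topology MeasureTheory

noncomputable section

/-- The mini-boson-star ODE system for `f, A, C` on a set `s ⊆ (0, ∞)`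
(prime denotes `d/dx`):
`(x² f'/C)' = (x²/(A C))·(1 − A C²)·f`,
`A' = (1 − A)/x − x·(A f'² + A C² f² + f²)`,
`C' = (C/(x A))·(A − 1 + x² f²)`, with `A > 0` and `C > 0`. -/
def MiniBosonSystem (f A C : ℝ → ℝ) (s : Set ℝ) : Prop :=
  ∀ x ∈ s, 0 < x ∧ 0 < A x ∧ 0 < C x ∧
    DifferentiableAt ℝ f x ∧ DifferentiableAt ℝ (deriv f) x ∧
    DifferentiableAt ℝ A x ∧ DifferentiableAt ℝ C x ∧
    deriv (fun y => y ^ 2 * deriv f y / C y) x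
      = x ^ 2 / (A x * C x) * (1 - A x * C x ^ 2) * f x ∧
    deriv A x = (1 - A x) / x
      - x * (A x * deriv f x ^ 2 + A x * C x ^ 2 * f x ^ 2 + f x ^ 2) ∧
    deriv C x = C x / (x * A x) * (A x - 1 + x ^ 2 * f x ^ 2)

/-- A domain of the form `[0, x̄)` with `0 < x̄ ≤ ∞`. -/
def IsOrbitDomain (s : Set ℝ) : Prop :=
  s = Set.Ici (0 : ℝ) ∨ ∃ xbar > (0 : ℝ), s = Set.Ico 0 xbar

/-- An `a`-orbit of the mini-boson-star system with parameters `a, α` on the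
domain `s = [0, x̄)`: a solution of the system on `s \ {0}`, continuous up to
`x = 0` with `f` differentiable at `0`, satisfying `f 0 = a`, `f' 0 = 0`,
`A 0 = 1`, `C 0 = α`. -/
def IsAOrbit (f A C : ℝ → ℝ) (a α : ℝ) (s : Set ℝ) : Prop :=
  IsOrbitDomain s ∧
  MiniBosonSystem f A C (s \ {0}) ∧
  ContinuousWithinAt f s 0 ∧ ContinuousWithinAt A s 0 ∧ ContinuousWithinAt C s 0 ∧
  HasDerivWithinAt f 0 s 0 ∧
  f 0 = a ∧ A 0 = 1 ∧ C 0 = α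

/-- The mass function `M(x) = x (1 − A x)/2`. -/
def massFn (A : ℝ → ℝ) (x : ℝ) : ℝ := x * (1 - A x) / 2

/-- `θ` is the rotation function of the orbit with scalar field `f`:
`θ` is continuous on the domain, `θ 0 = 0`, and for every `x` in the domain
there is `ρ x > 0` with `f x = ρ x · cos (θ x)` and `f' x = −ρ x · sin (θ x)`. -/
def IsRotation (f θ : ℝ → ℝ) (s : Set ℝ) : Prop :=
  ContinuousOn θ s ∧ θ 0 = 0 ∧
  ∀ x ∈ s, ∃ ρ > (0 : ℝ), f x = ρ * Real.cos (θ x) ∧ deriv f x = -(ρ * Real.sin (θ x))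

/-- A function differentiable on `[a, b)` whose derivative is bounded above is bounded above. -/
theorem exists_upper_bound_of_deriv_le {h : ℝ → ℝ} {a b L : ℝ}
    (hd : ∀ x ∈ Set.Ico a b, DifferentiableAt ℝ h x)
    (hL : ∀ x ∈ Set.Ico a b, deriv h x ≤ L) :
    ∃ M : ℝ, ∀ x ∈ Set.Ico a b, h x ≤ M := by
  refine ⟨h a + |L| * (b - a), fun x hx => ?_⟩
  have h1 := (convex_Ico a b).image_sub_le_mul_sub_of_deriv_le (f := h) (C := L)
    (fun y hy => (hd y hy).continuousAt.continuousWithinAt)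
    (fun y hy => (hd y (interior_subset hy)).differentiableWithinAt)
    (fun y hy => hL y (interior_subset hy)) a ⟨le_rfl, hx.1.trans_lt hx.2⟩ x hx hx.1
  have h2 : L * (x - a) ≤ |L| * (x - a) :=
    mul_le_mul_of_nonneg_right (le_abs_self L) (sub_nonneg.2 hx.1)
  have h3 : |L| * (x - a) ≤ |L| * (b - a) :=
    mul_le_mul_of_nonneg_left (by linarith [hx.2]) (abs_nonneg L)
  linarith

/-- A function differentiable on `[a, b)` with bounded derivative is bounded. -/
theorem exists_abs_bound_of_abs_deriv_le {h : ℝ → ℝ} {a b L : ℝ}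
    (hd : ∀ x ∈ Set.Ico a b, DifferentiableAt ℝ h x)
    (hL : ∀ x ∈ Set.Ico a b, |deriv h x| ≤ L) :
    ∃ M : ℝ, ∀ x ∈ Set.Ico a b, |h x| ≤ M := by
  obtain ⟨M₁, hM₁⟩ := exists_upper_bound_of_deriv_le hd fun x hx => (abs_le.1 (hL x hx)).2
  obtain ⟨M₂, hM₂⟩ := exists_upper_bound_of_deriv_le (h := fun x => -h x) (L := L)
    (fun x hx => (hd x hx).neg) fun x hx => by
      rw [deriv.fun_neg]; linarith [(abs_le.1 (hL x hx)).1]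
  exact ⟨max M₁ M₂, fun x hx => abs_le'.2
    ⟨(hM₁ x hx).trans (le_max_left _ _), (hM₂ x hx).trans (le_max_right _ _)⟩⟩

namespace MiniBosonSystem

variable {f A C : ℝ → ℝ} {x₀ xbar ε : ℝ}

/-- As `A' ≤ 1 / x₀ - x₀ ε f'²`, adding a large multiple of `A` to `c f`, with `c² = 1`, gives a
function whose derivative is bounded above. -/
theorem exists_upper_bound_mul_scalar (hx₀ : 0 < x₀)
    (hsys : MiniBosonSystem f A C (Set.Ico x₀ xbar)) (hε : 0 < ε)
    (hAε : ∀ x ∈ Set.Ico x₀ xbar, ε ≤ A x) {c : ℝ} (hc : c ^ 2 = 1) :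
    ∃ M : ℝ, ∀ x ∈ Set.Ico x₀ xbar, c * f x ≤ M := by
  have hk : 0 < 1 / (2 * x₀ * ε) := by positivity
  have hk1 : 1 / (2 * x₀ * ε) * (x₀ * ε) = 1 / 2 := by field_simp
  set k := 1 / (2 * x₀ * ε)
  obtain ⟨M, hM⟩ := exists_upper_bound_of_deriv_le (h := fun x => c * f x + k * A x)
    (a := x₀) (b := xbar) (L := 1 / 2 + k * (1 / x₀))
    (fun x hx => by
      obtain ⟨-, -, -, hf, -, hA, -⟩ := hsys x hx
      exact (hf.const_mul c).add (hA.const_mul k))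
    (fun x hx => by
      obtain ⟨hx0, hA0, hC0, hf, -, hA, -, -, hA', -⟩ := hsys x hx
      rw [((hf.hasDerivAt.const_mul c).fun_add (hA.hasDerivAt.const_mul k)).deriv, hA']
      have h1 : (1 - A x) / x ≤ 1 / x₀ :=
        div_le_div₀ zero_le_one (by linarith) hx₀ hx.1
      have h2 : x₀ * ε * deriv f x ^ 2
          ≤ x * (A x * deriv f x ^ 2 + A x * C x ^ 2 * f x ^ 2 + f x ^ 2) := by
        rw [mul_assoc]
        have h3 : 0 ≤ A x * C x ^ 2 * f x ^ 2 := by positivity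
        have h4 := mul_le_mul_of_nonneg_right (hAε x hx) (sq_nonneg (deriv f x))
        exact mul_le_mul hx.1 (by linarith [sq_nonneg (f x)]) (by positivity) hx0.le
      have h5 := mul_le_mul_of_nonneg_left (sub_le_sub h1 h2) hk.le
      have h6 : k * (x₀ * ε * deriv f x ^ 2) = 1 / 2 * deriv f x ^ 2 := by
        rw [← mul_assoc, hk1]
      have h7 : c * deriv f x ≤ 1 / 2 + 1 / 2 * deriv f x ^ 2 := by
        nlinarith [sq_nonneg (c - deriv f x)]
      rw [mul_sub k (1 / x₀), h6] at h5
      linarith)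
  refine ⟨M, fun x hx => ?_⟩
  have h1 := hM x hx
  have h2 : 0 < k * A x := mul_pos hk (hsys x hx).2.1
  linarith

theorem exists_abs_bound_scalar (hx₀ : 0 < x₀)
    (hsys : MiniBosonSystem f A C (Set.Ico x₀ xbar)) (hε : 0 < ε)
    (hAε : ∀ x ∈ Set.Ico x₀ xbar, ε ≤ A x) :
    ∃ M : ℝ, ∀ x ∈ Set.Ico x₀ xbar, |f x| ≤ M := by
  obtain ⟨M₁, hM₁⟩ := exists_upper_bound_mul_scalar hx₀ hsys hε hAε (c := 1) (by norm_num)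
  obtain ⟨M₂, hM₂⟩ := exists_upper_bound_mul_scalar hx₀ hsys hε hAε (c := -1) (by norm_num)
  refine ⟨max M₁ M₂, fun x hx => abs_le'.2 ⟨le_max_of_le_left ?_, le_max_of_le_right ?_⟩⟩
  · simpa using hM₁ x hx
  · simpa using hM₂ x hx

/-- The logarithmic derivative of `C` is bounded once `f` is, so `C` and `1 / C` are bounded. -/
theorem exists_bound_lapse (hx₀ : 0 < x₀)
    (hsys : MiniBosonSystem f A C (Set.Ico x₀ xbar))
    (hA1 : ∀ x ∈ Set.Ico x₀ xbar, A x < 1) (hε : 0 < ε)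
    (hAε : ∀ x ∈ Set.Ico x₀ xbar, ε ≤ A x) {F : ℝ}
    (hF : ∀ x ∈ Set.Ico x₀ xbar, |f x| ≤ F) :
    ∃ N : ℝ, ∀ x ∈ Set.Ico x₀ xbar, C x ≤ N ∧ 1 / C x ≤ N := by
  obtain ⟨M, hM⟩ := exists_abs_bound_of_abs_deriv_le (h := fun x => Real.log (C x))
    (a := x₀) (b := xbar) (L := (1 + xbar ^ 2 * F ^ 2) / (x₀ * ε))
    (fun x hx => by
      obtain ⟨-, -, hC0, -, -, -, hC, -⟩ := hsys x hx
      exact hC.log hC0.ne')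
    (fun x hx => by
      obtain ⟨hx0, hA0, hC0, -, -, -, hC, -, -, hC'⟩ := hsys x hx
      rw [deriv.log hC hC0.ne', hC']
      have h1 : C x / (x * A x) * (A x - 1 + x ^ 2 * f x ^ 2) / C x
          = (A x - 1 + x ^ 2 * f x ^ 2) / (x * A x) := by field_simp
      rw [h1, abs_div, abs_of_pos (mul_pos hx0 hA0)]
      have h2 : x ^ 2 * f x ^ 2 ≤ xbar ^ 2 * F ^ 2 := by
        rw [← sq_abs (f x)]
        gcongr
        · exact hx.2.le
        · exact hF x hx
      have h3 : 0 ≤ x ^ 2 * f x ^ 2 := by positivity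
      refine div_le_div₀ (by positivity) (abs_le.2 ⟨?_, ?_⟩) (by positivity)
        (mul_le_mul hx.1 (hAε x hx) hε.le hx0.le)
      · linarith
      · linarith [hA1 x hx])
  refine ⟨Real.exp M, fun x hx => ?_⟩
  obtain ⟨-, -, hC0, -⟩ := hsys x hx
  obtain ⟨h1, h2⟩ := abs_le.1 (hM x hx)
  refine ⟨(Real.log_le_iff_le_exp hC0).1 h2, ?_⟩
  rw [one_div, ← Real.log_le_iff_le_exp (inv_pos.2 hC0), Real.log_inv]
  linarith

/-- The momentum `x² f' / C` has bounded derivative once `f`, `C` and `1 / C` are bounded. -/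
theorem exists_abs_bound_deriv_scalar (hx₀ : 0 < x₀)
    (hsys : MiniBosonSystem f A C (Set.Ico x₀ xbar))
    (hA1 : ∀ x ∈ Set.Ico x₀ xbar, A x < 1) (hε : 0 < ε)
    (hAε : ∀ x ∈ Set.Ico x₀ xbar, ε ≤ A x) {F N : ℝ}
    (hF : ∀ x ∈ Set.Ico x₀ xbar, |f x| ≤ F)
    (hN : ∀ x ∈ Set.Ico x₀ xbar, C x ≤ N ∧ 1 / C x ≤ N) :
    ∃ M : ℝ, ∀ x ∈ Set.Ico x₀ xbar, |deriv f x| ≤ M := by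
  obtain ⟨M, hM⟩ := exists_abs_bound_of_abs_deriv_le
    (h := fun y => y ^ 2 * deriv f y / C y)
    (a := x₀) (b := xbar) (L := xbar ^ 2 * (1 / ε) * N * (1 + N ^ 2) * F)
    (fun x hx => by
      obtain ⟨-, -, hC0, -, hf', -, hC, -⟩ := hsys x hx
      exact ((differentiableAt_id.pow 2).mul hf').div hC hC0.ne')
    (fun x hx => by
      obtain ⟨hx0, hA0, hC0, -, -, -, -, hu', -⟩ := hsys x hx
      obtain ⟨hN1, hN2⟩ := hN x hx
      have hN0 : 0 < N := hC0.trans_le hN1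
      have h1 : x ^ 2 / (A x * C x) = x ^ 2 * (1 / A x) * (1 / C x) := by field_simp
      have h2 : |1 - A x * C x ^ 2| ≤ 1 + N ^ 2 := by
        have h3 : A x * C x ^ 2 ≤ 1 * N ^ 2 :=
          mul_le_mul (hA1 x hx).le (pow_le_pow_left₀ hC0.le hN1 2) (by positivity) zero_le_one
        have h4 : 0 ≤ A x * C x ^ 2 := by positivity
        exact abs_le.2 ⟨by linarith, by linarith [sq_nonneg N]⟩
      rw [hu', h1, abs_mul, abs_mul,
        abs_of_pos (show 0 < x ^ 2 * (1 / A x) * (1 / C x) by positivity)]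
      have hxb : x ≤ xbar := hx.2.le
      have hxb0 : 0 ≤ xbar := hx0.le.trans hxb
      gcongr
      · exact hAε x hx
      · exact hF x hx)
  refine ⟨M * N / x₀ ^ 2, fun x hx => ?_⟩
  obtain ⟨hx0, -, hC0, -⟩ := hsys x hx
  have hu := hM x hx
  have h1 : deriv f x = x ^ 2 * deriv f x / C x * C x / x ^ 2 := by field_simp
  have hM0 : 0 ≤ M := (abs_nonneg _).trans hu
  have hN1 := (hN x hx).1
  have hN0 : 0 ≤ N := hC0.le.trans hN1
  have hx1 := hx.1
  rw [h1, abs_div, abs_mul, abs_of_pos hC0, abs_of_pos (pow_pos hx0 2)]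
  gcongr

end MiniBosonSystem

/-- If the system is solved on `[x₀, x̄)` with `0 < A < 1` and `A` bounded away
from zero, then `f`, `f'`, `C` and `1/C` are bounded on `[x₀, x̄)`. -/
theorem bounded_while_A_positive (f A C : ℝ → ℝ) (x₀ xbar : ℝ)
    (hx₀ : 0 < x₀) (hx : x₀ < xbar)
    (hsys : MiniBosonSystem f A C (Set.Ico x₀ xbar))
    (hA1 : ∀ x ∈ Set.Ico x₀ xbar, A x < 1)
    (ε : ℝ) (hε : 0 < ε) (hAε : ∀ x ∈ Set.Ico x₀ xbar, ε ≤ A x) :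
    ∃ K : ℝ, ∀ x ∈ Set.Ico x₀ xbar,
      |f x| ≤ K ∧ |deriv f x| ≤ K ∧ C x ≤ K ∧ 1 / C x ≤ K := by
  obtain ⟨F, hF⟩ := hsys.exists_abs_bound_scalar hx₀ hε hAε
  obtain ⟨N, hN⟩ := hsys.exists_bound_lapse hx₀ hA1 hε hAε hF
  obtain ⟨D, hD⟩ := hsys.exists_abs_bound_deriv_scalar hx₀ hA1 hε hAε hF hN
  exact ⟨max F (max D N), fun x hx => ⟨le_max_of_le_left (hF x hx),
    le_max_of_le_right (le_max_of_le_left (hD x hx)),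
    le_max_of_le_right (le_max_of_le_right (hN x hx).1),
    le_max_of_le_right (le_max_of_le_right (hN x hx).2)⟩⟩
end
end

section
/- Let (f, A, C) be an a-orbit of the mini-boson-star system with parameters a > 0, α > 1, defined on [0, x̄), with (f(x), f'(x)) ≠ (0, 0) for all x, and let θ be its rotation function. If θ(x₁) > (n + 1/2)π for some x₁ in the domain and some nonnegative integer n, then θ(x) > (n + 1/2)π for all x > x₁ in the domain. -/
open Real Set Filter Topology MeasureTheory

noncomputable section

theorem cos_nat_add_half_mul_pi (n : ℕ) : Real.cos (((n : ℝ) + 1 / 2) * Real.pi) = 0 :=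
  Real.cos_eq_zero_iff.2 ⟨n, by push_cast; ring⟩

/-- If `f = ρ cos θ` and `f' = -ρ sin θ` with `ρ > 0`, then `θ` cannot decrease to a zero `c` of the
cosine as `t` is approached from the left. -/
theorem not_eventually_left_gt_of_polar {f θ : ℝ → ℝ} {t c : ℝ} (hc : Real.cos c = 0)
    (hf : DifferentiableAt ℝ f t) (htc : θ t = c)
    (hθ : Tendsto θ (𝓝[<] t) (𝓝 c))
    (ht : ∃ ρ > (0 : ℝ), f t = ρ * Real.cos (θ t) ∧ deriv f t = -(ρ * Real.sin (θ t)))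
    (hpolar : ∀ᶠ y in 𝓝[<] t, ∃ ρ > (0 : ℝ), f y = ρ * Real.cos (θ y)) :
    ¬ ∀ᶠ y in 𝓝[<] t, c < θ y := by
  intro hgt
  obtain ⟨ρ, hρ, hft, hdf⟩ := ht
  rw [htc] at hft hdf
  rw [hc, mul_zero] at hft
  have hsin : Real.sin c ^ 2 = 1 := by
    have := Real.sin_sq_add_cos_sq c
    rw [hc] at this
    linarith
  have hslope : Tendsto (fun y => slope f t y * Real.sin c) (𝓝[<] t)
      (𝓝 (deriv f t * Real.sin c)) :=
    ((hasDerivAt_iff_tendsto_slope.1 hf.hasDerivAt).mono_left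
      (nhdsWithin_mono t fun y (hy : y < t) => hy.ne)).mul_const _
  have hlt : ∀ᶠ y in 𝓝[<] t, θ y < c + Real.pi :=
    hθ.eventually_lt_const (by linarith [Real.pi_pos])
  have hnonneg : 0 ≤ deriv f t * Real.sin c := by
    refine ge_of_tendsto hslope ?_
    filter_upwards [hgt, hlt, hpolar, self_mem_nhdsWithin] with y hy₁ hy₂ hy₃ (hy₄ : y < t)
    obtain ⟨r, hr, hfy⟩ := hy₃
    have hpos : 0 < Real.sin (θ y - c) :=
      Real.sin_pos_of_pos_of_lt_pi (by linarith) (by linarith)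
    have hcos : Real.cos (θ y) = -(Real.sin (θ y - c) * Real.sin c) := by
      have := Real.cos_add (θ y - c) c
      rw [sub_add_cancel, hc] at this
      linarith
    have heq : slope f t y * Real.sin c = r * Real.sin (θ y - c) / (t - y) := by
      have : t - y ≠ 0 := by linarith
      have h' : y - t ≠ 0 := by linarith
      rw [slope_def_field, hft, hfy, hcos]
      field_simp
      linear_combination (-(r * Real.sin (θ y - c) * (t - y))) * hsin
    rw [heq]
    exact div_nonneg (mul_pos hr hpos).le (by linarith)
  rw [hdf] at hnonneg
  nlinarith

/-- If the rotation function of an `a`-orbit satisfies `θ x₁ > (n + 1/2)π`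
for some `x₁` in the domain, then `θ x > (n + 1/2)π` for all later `x` in the
domain. -/
theorem rotation_no_return_half (f A C θ : ℝ → ℝ) (a α : ℝ) (s : Set ℝ)
    (ha : 0 < a) (hα : 1 < α) (horbit : IsAOrbit f A C a α s)
    (hnv : ∀ x ∈ s, (f x, deriv f x) ≠ (0, 0))
    (hθ : IsRotation f θ s) (n : ℕ) (x₁ : ℝ) (hx₁ : x₁ ∈ s)
    (h : ((n : ℝ) + 1 / 2) * Real.pi < θ x₁) :
    ∀ x ∈ s, x₁ < x → ((n : ℝ) + 1 / 2) * Real.pi < θ x := by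
  intro x hx hlt
  by_contra! hle
  set c := ((n : ℝ) + 1 / 2) * Real.pi with hc
  have hcpos : 0 < c := by positivity
  obtain ⟨hdom, hsys, -⟩ := horbit
  obtain ⟨hcont, hθ0, hpolar⟩ := hθ
  have hs : s.OrdConnected ∧ s ⊆ Set.Ici 0 := by
    rcases hdom with rfl | ⟨b, -, rfl⟩
    · exact ⟨Set.ordConnected_Ici, subset_rfl⟩
    · exact ⟨Set.ordConnected_Ico, Set.Ico_subset_Ici_self⟩
  have hsub : Set.Icc x₁ x ⊆ s := hs.1.out hx₁ hx
  have hx₁pos : 0 < x₁ := by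
    refine lt_of_le_of_ne (hs.2 hx₁) ?_
    rintro rfl
    linarith
  have hcontI : ContinuousOn θ (Set.Icc x₁ x) := hcont.mono hsub
  have hcompact : IsCompact (Set.Icc x₁ x ∩ θ ⁻¹' Set.Iic c) :=
    isCompact_Icc.of_isClosed_subset (hcontI.preimage_isClosed_of_isClosed isClosed_Icc isClosed_Iic)
      Set.inter_subset_left
  obtain ⟨t, ⟨htI, htle⟩, hleast⟩ := hcompact.exists_isLeast ⟨x, ⟨hlt.le, le_rfl⟩, hle⟩
  have htle' : θ t ≤ c := htle
  have hx₁t : x₁ < t := by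
    refine lt_of_le_of_ne htI.1 ?_
    rintro rfl
    linarith
  have hmem : Set.Ioo x₁ t ∈ 𝓝[<] t := Ioo_mem_nhdsLT hx₁t
  have hgt : ∀ᶠ y in 𝓝[<] t, c < θ y := by
    filter_upwards [hmem] with y hy
    by_contra! hyc
    exact hy.2.not_ge (hleast ⟨⟨hy.1.le, hy.2.le.trans htI.2⟩, hyc⟩)
  have hlim : Tendsto θ (𝓝[<] t) (𝓝 (θ t)) :=
    (hcontI t htI).tendsto.mono_left (nhdsWithin_le_iff.2 (mem_of_superset hmem
      fun y hy => ⟨hy.1.le, hy.2.le.trans htI.2⟩))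
  have htc : θ t = c := le_antisymm htle' (ge_of_tendsto hlim (hgt.mono fun _ hy => hy.le))
  have hdiff : DifferentiableAt ℝ f t :=
    (hsys t ⟨hsub htI, (hx₁pos.trans hx₁t).ne'⟩).2.2.2.1
  refine not_eventually_left_gt_of_polar (cos_nat_add_half_mul_pi n) hdiff htc (by rwa [htc] at hlim)
    (hpolar t (hsub htI)) ?_ hgt
  filter_upwards [hmem] with y hy
  obtain ⟨ρ, hρ, hfy, -⟩ := hpolar y (hsub ⟨hy.1.le, hy.2.le.trans htI.2⟩)
  exact ⟨ρ, hρ, hfy⟩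
end
end

section
/- Let (f, A, C) be an a-orbit of the mini-boson-star system with parameters a > 0, α > 1, defined on [0, x̄), with (f(x), f'(x)) ≠ (0, 0) for all x, let θ be its rotation function, and let g = 1 − A C². If for some x₁ in the domain and some nonnegative integer n one has θ(x₁) < nπ and g(x₁) ≥ 0, then θ(x) < nπ for all x > x₁ in the domain. -/
open Real Set Filter Topology MeasureTheory

noncomputable section

theorem IsOrbitDomain.nonneg {s : Set ℝ} (hs : IsOrbitDomain s) {x : ℝ} (hx : x ∈ s) :
    0 ≤ x := by
  rcases hs with rfl | ⟨b, -, rfl⟩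
  exacts [hx, hx.1]

theorem IsOrbitDomain.mem_of_le {s : Set ℝ} (hs : IsOrbitDomain s) {x y : ℝ} (hx : x ∈ s)
    (hy : 0 ≤ y) (hyx : y ≤ x) : y ∈ s := by
  rcases hs with rfl | ⟨b, -, rfl⟩
  exacts [hy, ⟨hy, hyx.trans_lt hx.2⟩]

/-- The mass function has derivative `x² (A f'² + A C² f² + f²)/2`. -/
theorem MiniBosonSystem.hasDerivAt_massFn {f A C : ℝ → ℝ} {s : Set ℝ}
    (h : MiniBosonSystem f A C s) {x : ℝ} (hx : x ∈ s) :
    HasDerivAt (massFn A)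
      (x ^ 2 * (A x * deriv f x ^ 2 + A x * C x ^ 2 * f x ^ 2 + f x ^ 2) / 2) x := by
  obtain ⟨hx0, -, -, -, -, hA, -, -, hA', -⟩ := h x hx
  have hd := ((hasDerivAt_id x).mul (hA.hasDerivAt.const_sub 1)).div_const 2
  refine hd.congr_deriv ?_
  rw [hA']
  simp only [id]
  field_simp
  ring

/-- The function `g = 1 − A C²` satisfies `g' = C² ((1 − A)/x − x f² g + x A f'²)`. -/
theorem MiniBosonSystem.hasDerivAt_one_sub {f A C : ℝ → ℝ} {s : Set ℝ}
    (h : MiniBosonSystem f A C s) {x : ℝ} (hx : x ∈ s) :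
    HasDerivAt (fun y => 1 - A y * C y ^ 2)
      (C x ^ 2 * ((1 - A x) / x - x * f x ^ 2 * (1 - A x * C x ^ 2)
        + x * A x * deriv f x ^ 2)) x := by
  obtain ⟨hx0, hA0, -, -, -, hA, hC, -, hA', hC'⟩ := h x hx
  refine ((hA.hasDerivAt.mul (hC.hasDerivAt.pow 2)).const_sub 1).congr_deriv ?_
  rw [hA', hC']
  simp only [Pi.pow_apply]
  field_simp
  ring

/-- The weighted product `f · (x² f'/C)` has derivative
`x² f'²/C + (x²/(A C)) (1 − A C²) f²`. -/
theorem MiniBosonSystem.hasDerivAt_mul_flux {f A C : ℝ → ℝ} {s : Set ℝ}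
    (h : MiniBosonSystem f A C s) {x : ℝ} (hx : x ∈ s) :
    HasDerivAt (fun y => f y * (y ^ 2 * deriv f y / C y))
      (x ^ 2 * deriv f x ^ 2 / C x
        + x ^ 2 / (A x * C x) * (1 - A x * C x ^ 2) * f x ^ 2) x := by
  obtain ⟨-, -, hC0, hf, hf', -, hC, hflux, -, -⟩ := h x hx
  have hd : DifferentiableAt ℝ (fun y => y ^ 2 * deriv f y / C y) x :=
    ((differentiableAt_id.pow 2).mul hf').div hC hC0.ne'
  refine (hf.hasDerivAt.mul hd.hasDerivAt).congr_deriv ?_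
  rw [hflux]
  ring

/-- The metric coefficient `A` of an `a`-orbit is at most one. -/
theorem IsAOrbit.metric_le_one {f A C : ℝ → ℝ} {a α : ℝ} {s : Set ℝ}
    (h : IsAOrbit f A C a α s) {x : ℝ} (hx : x ∈ s) (hx0 : 0 < x) : A x ≤ 1 := by
  obtain ⟨hs, hsys, -, hA, -⟩ := h
  have hmem : ∀ y ∈ Ioc 0 x, y ∈ s \ {0} := fun y hy =>
    ⟨hs.mem_of_le hx hy.1.le hy.2, hy.1.ne'⟩
  have hcont : ContinuousOn (massFn A) (Icc 0 x) := by
    intro y hy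
    rcases hy.1.eq_or_lt with rfl | hy0
    · have hA' := hA.mono fun y (hy : y ∈ Icc 0 x) => hs.mem_of_le hx hy.1 hy.2
      exact (continuousWithinAt_id.mul (continuousWithinAt_const.sub hA')).div_const 2
    · exact (hsys.hasDerivAt_massFn (hmem y ⟨hy0, hy.2⟩)).continuousAt.continuousWithinAt
  have hmono : MonotoneOn (massFn A) (Icc 0 x) := by
    have hint : ∀ y ∈ interior (Icc 0 x), y ∈ s \ {0} := fun y hy =>
      hmem y (Ioo_subset_Ioc_self (interior_Icc.subset hy))
    refine monotoneOn_of_hasDerivWithinAt_nonneg (convex_Icc 0 x) hcont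
      (fun y hy => (hsys.hasDerivAt_massFn (hint y hy)).hasDerivWithinAt) (fun y hy => ?_)
    have := (hsys y (hint y hy)).2.1
    positivity
  have hmass : massFn A 0 ≤ massFn A x :=
    hmono (left_mem_Icc.2 hx0.le) (right_mem_Icc.2 hx0.le) hx0.le
  simp only [massFn] at hmass
  have : 0 ≤ x * (1 - A x) := by linarith
  linarith [nonneg_of_mul_nonneg_right this hx0]

/-- Nonnegativity of `g = 1 − A C²` persists along an `a`-orbit. -/
theorem IsAOrbit.one_sub_nonneg {f A C : ℝ → ℝ} {a α : ℝ} {s : Set ℝ}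
    (h : IsAOrbit f A C a α s) {x y : ℝ} (hx0 : 0 < x) (hxy : x ≤ y) (hy : y ∈ s)
    (hg : 0 ≤ 1 - A x * C x ^ 2) : 0 ≤ 1 - A y * C y ^ 2 := by
  set g : ℝ → ℝ := fun z => 1 - A z * C z ^ 2 with hgdef
  change 0 ≤ g y
  by_contra! hneg
  have hmem : ∀ z ∈ Icc x y, z ∈ s \ {0} := fun z hz =>
    ⟨h.1.mem_of_le hy (hx0.le.trans hz.1) hz.2, (hx0.trans_le hz.1).ne'⟩
  have hcont : ContinuousOn g (Icc x y) := fun z hz =>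
    (h.2.1.hasDerivAt_one_sub (hmem z hz)).continuousAt.continuousWithinAt
  have hcompact : IsCompact (Icc x y ∩ g ⁻¹' Ici 0) :=
    isCompact_Icc.of_isClosed_subset
      (hcont.preimage_isClosed_of_isClosed isClosed_Icc isClosed_Ici) inter_subset_left
  obtain ⟨w, ⟨hw, hgw⟩, hmax⟩ := hcompact.exists_isGreatest ⟨x, left_mem_Icc.2 hxy, hg⟩
  have hsub : Icc w y ⊆ Icc x y := Icc_subset_Icc_left hw.1
  have hmono : MonotoneOn g (Icc w y) := by
    refine monotoneOn_of_hasDerivWithinAt_nonneg (convex_Icc w y) (hcont.mono hsub)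
      (fun z hz => (h.2.1.hasDerivAt_one_sub
        (hmem z (hsub (interior_subset hz)))).hasDerivWithinAt) (fun z hz => ?_)
    have hzs := hmem z (hsub (interior_subset hz))
    rw [interior_Icc] at hz
    have hgz : g z ≤ 0 := by
      by_contra! hpos
      exact absurd (hmax ⟨hsub ⟨hz.1.le, hz.2.le⟩, hpos.le⟩) (not_le.2 hz.1)
    obtain ⟨hz0, hA0, -⟩ := h.2.1 z hzs
    have hA1 : 0 ≤ (1 - A z) / z :=
      div_nonneg (sub_nonneg.2 (h.metric_le_one hzs.1 hz0)) hz0.le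
    have hfg : z * f z ^ 2 * (1 - A z * C z ^ 2) ≤ 0 :=
      mul_nonpos_of_nonneg_of_nonpos (by positivity) hgz
    have hdf : 0 ≤ z * A z * deriv f z ^ 2 := by positivity
    exact mul_nonneg (sq_nonneg _) (by linarith)
  have hle := hmono (left_mem_Icc.2 hw.2) (right_mem_Icc.2 hw.2) hw.2
  exact absurd hneg (not_lt.2 ((mem_Ici.1 hgw).trans hle))

/-- Once `g = 1 − A C²` is nonnegative, the weighted product `f · (x² f'/C)` is monotone. -/
theorem IsAOrbit.monotoneOn_mul_flux {f A C : ℝ → ℝ} {a α : ℝ} {s : Set ℝ}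
    (h : IsAOrbit f A C a α s) {x y : ℝ} (hx0 : 0 < x) (hy : y ∈ s)
    (hg : 0 ≤ 1 - A x * C x ^ 2) :
    MonotoneOn (fun z => f z * (z ^ 2 * deriv f z / C z)) (Icc x y) := by
  have hmem : ∀ z ∈ Icc x y, z ∈ s \ {0} := fun z hz =>
    ⟨h.1.mem_of_le hy (hx0.le.trans hz.1) hz.2, (hx0.trans_le hz.1).ne'⟩
  refine monotoneOn_of_hasDerivWithinAt_nonneg (convex_Icc x y)
    (fun z hz => (h.2.1.hasDerivAt_mul_flux (hmem z hz)).continuousAt.continuousWithinAt)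
    (fun z hz => (h.2.1.hasDerivAt_mul_flux
      (hmem z (interior_subset hz))).hasDerivWithinAt) (fun z hz => ?_)
  have hz := interior_subset hz
  obtain ⟨hz0, hA0, hC0, -⟩ := h.2.1 z (hmem z hz)
  have := h.one_sub_nonneg hx0 hz.1 (hmem z hz).1 hg
  positivity

/-- If the rotation function of an `a`-orbit satisfies `θ x₁ < nπ` at a point
where `g x₁ = 1 − A x₁ · C x₁ ² ≥ 0`, then `θ x < nπ` for all later `x` in the
domain. -/
theorem rotation_stays_below (f A C θ : ℝ → ℝ) (a α : ℝ) (s : Set ℝ)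
    (ha : 0 < a) (hα : 1 < α) (horbit : IsAOrbit f A C a α s)
    (hnv : ∀ x ∈ s, (f x, deriv f x) ≠ (0, 0))
    (hθ : IsRotation f θ s) (n : ℕ) (x₁ : ℝ) (hx₁ : x₁ ∈ s)
    (hθ₁ : θ x₁ < (n : ℝ) * Real.pi)
    (hg₁ : 0 ≤ 1 - A x₁ * C x₁ ^ 2) :
    ∀ x ∈ s, x₁ < x → θ x < (n : ℝ) * Real.pi := by
  intro x hx hlt
  by_contra! hge
  obtain ⟨hcont, -, hpolar⟩ := hθ
  have hs := horbit.1
  have hx₁0 : 0 < x₁ := by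
    refine (hs.nonneg hx₁).lt_of_ne' ?_
    rintro rfl
    obtain ⟨-, -, -, -, -, -, -, hA, hC⟩ := horbit
    rw [hA, hC] at hg₁
    nlinarith
  have hmem : ∀ y ∈ Icc x₁ x, y ∈ s := fun y hy => hs.mem_of_le hx (hx₁0.le.trans hy.1) hy.2
  obtain ⟨z, hz, hθz⟩ := intermediate_value_Icc hlt.le (hcont.mono hmem) ⟨hθ₁.le, hge⟩
  set c := max (θ x₁) (n * Real.pi - Real.pi / 4) with hc
  have hcn : c < n * Real.pi := max_lt hθ₁ (by linarith [Real.pi_pos])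
  obtain ⟨y, hy, hθy⟩ := intermediate_value_Icc hz.1
    (hcont.mono fun y hy => hmem y ⟨hy.1, hy.2.trans hz.2⟩) ⟨le_max_left _ _, hθz ▸ hcn.le⟩
  have hyx : y ∈ Icc x₁ x := ⟨hy.1, hy.2.trans hz.2⟩
  have hle := horbit.monotoneOn_mul_flux hx₁0 hx hg₁ hyx hz hy.2
  obtain ⟨r, -, -, hf'z⟩ := hpolar z (hmem z hz)
  have hf'z0 : deriv f z = 0 := by rw [hf'z, hθz, Real.sin_nat_mul_pi]; simp
  obtain ⟨ρ, hρ, hfy, hf'y⟩ := hpolar y (hmem y hyx)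
  obtain ⟨hy0, -, hC0, -⟩ := horbit.2.1 y ⟨hmem y hyx, (hx₁0.trans_le hy.1).ne'⟩
  have hsin : 0 < -Real.sin (2 * c) := by
    have hper : Real.sin (2 * c) = -Real.sin (2 * (n * Real.pi - c)) := by
      rw [← Real.sin_neg, ← Real.sin_sub_nat_mul_two_pi (2 * c) n]
      ring_nf
    rw [hper, neg_neg]
    exact Real.sin_pos_of_pos_of_lt_pi (by linarith)
      (by linarith [le_max_right (θ x₁) (n * Real.pi - Real.pi / 4), Real.pi_pos])
  rw [Real.sin_two_mul] at hsin
  have hpos : 0 < f y * (y ^ 2 * deriv f y / C y) := by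
    have heq : f y * (y ^ 2 * deriv f y / C y)
        = ρ ^ 2 * y ^ 2 / (2 * C y) * -(2 * Real.sin c * Real.cos c) := by
      rw [hfy, hf'y, hθy, ← hc]
      field_simp
    rw [heq]
    exact mul_pos (by positivity) hsin
  simp only [hf'z0, mul_zero, zero_div] at hle
  exact absurd hpos (not_lt.2 hle)
end
end

section
/- For every a > 0 and α > 0 there exist r > 0 and functions f, A, C : [0, r] → ℝ solving the mini-boson-star system on (0, r], continuous on [0, r] with f differentiable at 0, satisfying f(0) = a, f'(0) = 0, A(0) = 1, C(0) = α; moreover this local solution is unique. -/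
open Real Set Filter Topology MeasureTheory

noncomputable section

/-- A local solution on `[0, r]`: solves the system on `(0, r]`, is continuous
on `[0, r]` with `f` differentiable at `0`, and satisfies `f 0 = a`,
`f' 0 = 0`, `A 0 = 1`, `C 0 = α`. -/
def IsLocalSolution (f A C : ℝ → ℝ) (a α r : ℝ) : Prop :=
  MiniBosonSystem f A C (Set.Ioc 0 r) ∧
  ContinuousOn f (Set.Icc 0 r) ∧ ContinuousOn A (Set.Icc 0 r) ∧
  ContinuousOn C (Set.Icc 0 r) ∧
  HasDerivWithinAt f 0 (Set.Icc 0 r) 0 ∧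
  f 0 = a ∧ A 0 = 1 ∧ C 0 = α


/-- Multiplying a function continuous at `0` by the identity gives a function differentiable
at `0`. -/
theorem hasDerivWithinAt_id_smul {E : Type*} [NormedAddCommGroup E] [NormedSpace ℝ E]
    {g : ℝ → E} {s : Set ℝ} (hg : ContinuousWithinAt g s 0) :
    HasDerivWithinAt (fun x => x • g x) (g 0) s 0 := by
  rw [hasDerivWithinAt_iff_tendsto_slope]
  refine Tendsto.congr' ?_ (hg.mono_left (nhdsWithin_mono _ sdiff_subset))
  filter_upwards [self_mem_nhdsWithin] with x hx
  have hx0 : x ≠ 0 := fun h => hx.2 h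
  simp [slope_def_module, smul_smul, hx0]

theorem norm_integral_sq_smul_le {E : Type*} [NormedAddCommGroup E] [NormedSpace ℝ E]
    {G : ℝ → E} {B : ℝ} (hG : ∀ t, ‖G t‖ ≤ B) :
    ‖∫ t in (0 : ℝ)..1, t ^ 2 • G t‖ ≤ B / 3 := by
  have h : ∫ t in (0 : ℝ)..1, t ^ 2 * B = B / 3 := by
    rw [intervalIntegral.integral_mul_const, integral_pow]; norm_num; ring
  rw [← h]
  refine intervalIntegral.norm_integral_le_of_norm_le zero_le_one
    (Eventually.of_forall fun t _ => ?_) (Continuous.intervalIntegrable (by fun_prop) _ _)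
  rw [norm_smul, Real.norm_of_nonneg (sq_nonneg t)]
  exact mul_le_mul_of_nonneg_left (hG t) (sq_nonneg t)

/-- Existence for the singular equation `x w' = H(x, w) - 3 w` when `H` is Lipschitz in `w` with
constant less than `3`. -/
theorem exists_solution_singular_ode {E : Type*} [NormedAddCommGroup E] [NormedSpace ℝ E]
    [CompleteSpace E] {H : ℝ → E → E} {r R k : ℝ} (hr : 0 < r) (hR : 0 ≤ R) (hk0 : 0 ≤ k)
    (hk : k < 3)
    (hcont : ContinuousOn (Function.uncurry H) (Icc 0 r ×ˢ Metric.closedBall 0 R))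
    (hlip : ∀ x ∈ Icc 0 r, ∀ u ∈ Metric.closedBall (0 : E) R, ∀ v ∈ Metric.closedBall (0 : E) R,
      ‖H x u - H x v‖ ≤ k * ‖u - v‖)
    (hbd : ∀ x ∈ Icc 0 r, ∀ u ∈ Metric.closedBall (0 : E) R, ‖H x u‖ ≤ 3 * R) :
    ∃ w : ℝ → E, Continuous w ∧ (3 : ℝ) • w 0 = H 0 (w 0) ∧
      ∀ x ∈ Ioo 0 r, HasDerivAt w (x⁻¹ • (H x (w x) - (3 : ℝ) • w x)) x := by
  let X := C(Icc (0 : ℝ) r, Metric.closedBall (0 : E) R)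
  let F : X → ℝ → E := fun w s => H (projIcc 0 r hr.le s) (w (projIcc 0 r hr.le s))
  have hF : ∀ w, Continuous (F w) := fun w =>
    hcont.comp_continuous (f := fun s : ℝ => (((projIcc 0 r hr.le s : Icc 0 r) : ℝ),
        ((w (projIcc 0 r hr.le s) : Metric.closedBall (0 : E) R) : E)))
      (by have := continuous_projIcc (h := hr.le); fun_prop)
      (fun s => ⟨Subtype.coe_prop _, Subtype.coe_prop _⟩)
  have hFbd : ∀ w s, ‖F w s‖ ≤ 3 * R := fun w s =>
    hbd _ (Subtype.coe_prop _) _ (Subtype.coe_prop _)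
  have hFlip : ∀ w v s, ‖F w s - F v s‖ ≤ k * dist w v := fun w v s => by
    refine (hlip _ (Subtype.coe_prop _) _ (Subtype.coe_prop _) _ (Subtype.coe_prop _)).trans
      (mul_le_mul_of_nonneg_left ?_ hk0)
    rw [← dist_eq_norm]
    exact ContinuousMap.dist_apply_le_dist (f := w) (g := v) _
  let T : X → ℝ → E := fun w x => ∫ t in (0 : ℝ)..1, t ^ 2 • F w (x * t)
  have hint : ∀ w x, IntervalIntegrable (fun t => t ^ 2 • F w (x * t)) volume 0 1 := fun w x => by
    have := hF w
    exact Continuous.intervalIntegrable (by fun_prop) _ _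
  have hT : ∀ w, Continuous (T w) := fun w => by
    have := hF w
    exact intervalIntegral.continuous_parametric_intervalIntegral_of_continuous'
      (by fun_prop) 0 1
  have hTbd : ∀ w x, ‖T w x‖ ≤ R := fun w x =>
    (norm_integral_sq_smul_le fun t => hFbd w (x * t)).trans_eq (by ring)
  let Φ : X → X := fun w =>
    ⟨fun x => ⟨T w x, by simpa using hTbd w x⟩, by have := hT w; fun_prop⟩
  have hΦ : ContractingWith (k / 3).toNNReal Φ := by
    refine ⟨by rw [Real.toNNReal_lt_one]; linarith, LipschitzWith.of_dist_le_mul fun w v => ?_⟩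
    rw [Real.coe_toNNReal _ (by positivity), ContinuousMap.dist_le (by positivity)]
    intro x
    change dist (T w x) (T v x) ≤ _
    rw [dist_eq_norm]
    have : T w x - T v x = ∫ t in (0 : ℝ)..1, t ^ 2 • (F w (x * t) - F v (x * t)) := by
      simp only [T]
      rw [← intervalIntegral.integral_sub (hint _ _) (hint _ _)]
      simp only [smul_sub]
    rw [this]
    exact (norm_integral_sq_smul_le fun t => hFlip w v (x * t)).trans_eq (by ring)
  have : CompleteSpace (Metric.closedBall (0 : E) R) :=
    Metric.isClosed_closedBall.completeSpace_coe
  have : Nonempty X := ⟨⟨fun _ => ⟨0, by simpa using hR⟩, by fun_prop⟩⟩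
  set w := ContractingWith.fixedPoint Φ hΦ
  have hfix : Φ w = w := hΦ.fixedPoint_isFixedPt
  have hFw : ∀ s ∈ Icc 0 r, F w s = H s (T w s) := fun s hs => by
    have h1 : (w ⟨s, hs⟩ : E) = T w s := by
      conv_lhs => rw [← hfix]
      rfl
    simp only [F, projIcc_of_mem hr.le hs, h1]
  refine ⟨T w, hT w, ?_, fun x hx => ?_⟩
  · have h0 : T w 0 = (1 / 3 : ℝ) • F w 0 := by
      simp only [T, zero_mul]
      rw [intervalIntegral.integral_smul_const, integral_pow]
      norm_num
    rw [← hFw 0 ⟨le_rfl, hr.le⟩, h0, smul_smul]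
    norm_num
  · have hx0 : x ≠ 0 := hx.1.ne'
    have hsub : ∀ y : ℝ, y ^ 3 • T w y = ∫ s in (0 : ℝ)..y, s ^ 2 • F w s := fun y => by
      have h := intervalIntegral.smul_integral_comp_mul_left (a := 0) (b := 1)
        (fun s => s ^ 2 • F w s) y
      rw [mul_zero, mul_one] at h
      rw [← h, pow_succ', mul_smul]
      simp only [T, mul_pow, mul_smul, intervalIntegral.integral_smul]
    have hd : HasDerivAt (fun y => ∫ s in (0 : ℝ)..y, s ^ 2 • F w s) (x ^ 2 • F w x) x := by
      have := hF w
      exact (Continuous.integral_hasStrictDerivAt (by fun_prop) 0 x).hasDerivAt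
    have hinv : HasDerivAt (fun y : ℝ => (y ^ 3)⁻¹) (-(3 * x ^ 2) / (x ^ 3) ^ 2) x := by
      simpa using (hasDerivAt_pow 3 x).fun_inv (pow_ne_zero 3 hx0)
    have hprod := hinv.fun_smul hd
    rw [← hsub x, hFw x ⟨hx.1.le, hx.2.le⟩] at hprod
    refine (hprod.congr_of_eventuallyEq ?_).congr_deriv ?_
    · filter_upwards [lt_mem_nhds hx.1] with y hy
      rw [← hsub y, smul_smul, inv_mul_cancel₀ (pow_ne_zero 3 hy.ne'), one_smul]
    · rw [smul_sub, smul_smul, smul_smul, smul_smul, sub_eq_add_neg, ← neg_smul]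
      congr 2 <;> field_simp

/-- Uniqueness for the singular equation `x D' = g - 3 D` when `g` is controlled by `D` with
constant less than `3`. -/
theorem eq_zero_of_singular_ode {E : Type*} [NormedAddCommGroup E] [NormedSpace ℝ E]
    {D g : ℝ → E} {δ k : ℝ} (hk0 : 0 ≤ k) (hk : k < 3)
    (hD : ContinuousOn D (Icc 0 δ)) (hD0 : D 0 = 0)
    (hder : ∀ x ∈ Ioo 0 δ, HasDerivAt D (x⁻¹ • (g x - (3 : ℝ) • D x)) x)
    (hg : ∀ x ∈ Ioo 0 δ, ‖g x‖ ≤ k * ‖D x‖) :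
    ∀ x ∈ Icc 0 δ, D x = 0 := by
  intro x hx
  obtain ⟨y, hy, hmax⟩ := isCompact_Icc.exists_isMaxOn ⟨x, hx⟩ hD.norm
  have hmax' : ∀ z ∈ Icc 0 δ, ‖D z‖ ≤ ‖D y‖ := hmax
  suffices h : ‖D y‖ ≤ 0 from norm_le_zero_iff.1 ((hmax' x hx).trans h)
  rcases hy.1.eq_or_lt with h0 | hpos
  · simp [← h0, hD0]
  have key := image_norm_le_of_norm_deriv_right_le_deriv_boundary (a := 0) (b := δ)
    (f := fun x => x ^ 3 • D x) (f' := fun x => if x = 0 then 0 else x ^ 2 • g x)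
    (B := fun x => k * ‖D y‖ / 3 * x ^ 3) (B' := fun x => k * ‖D y‖ / 3 * (3 * x ^ 2))
    (by fun_prop) (fun z hz => ?_) (by simp)
    (fun z => by simpa using (hasDerivAt_pow 3 z).const_mul (k * ‖D y‖ / 3)) (fun z hz => ?_) hy
  · rw [norm_smul, Real.norm_of_nonneg (by positivity)] at key
    have h3 : 0 < y ^ 3 := by positivity
    by_contra! hlt
    have : 0 < y ^ 3 * ((3 - k) * ‖D y‖) := mul_pos h3 (mul_pos (by linarith) hlt)
    nlinarith
  · rcases hz.1.eq_or_lt with h0 | hz0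
    · subst h0
      have hc : ContinuousWithinAt (fun x : ℝ => x ^ 2 • D x) (Icc 0 δ) 0 := by
        have := hD 0 ⟨le_rfl, hz.2.le⟩
        exact (continuousWithinAt_id.pow 2).smul this
      have h := hasDerivWithinAt_id_smul hc
      simp only [smul_smul, ← pow_succ', ne_eq, OfNat.ofNat_ne_zero, not_false_eq_true, zero_pow,
        zero_smul] at h
      simpa using h.mono_of_mem_nhdsWithin (Icc_mem_nhdsGE hz.2)
    · have h := ((hasDerivAt_pow 3 z).fun_smul (hder z ⟨hz0, hz.2⟩)).hasDerivWithinAt (s := Ici z)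
      rw [if_neg hz0.ne']
      refine h.congr_deriv ?_
      rw [smul_smul, smul_sub, smul_smul]
      have e1 : z ^ 3 * z⁻¹ = z ^ 2 := by field_simp
      have e2 : z ^ 2 * 3 = 3 * z ^ 2 := mul_comm _ _
      rw [e1, e2]
      simp
  · rcases hz.1.eq_or_lt with h0 | hz0
    · simp [← h0]
    · rw [if_neg hz0.ne', norm_smul, Real.norm_of_nonneg (by positivity)]
      have h1 := hg z ⟨hz0, hz.2⟩
      have h2 := mul_le_mul_of_nonneg_left (hmax' z ⟨hz.1, hz.2.le⟩) hk0
      nlinarith [mul_le_mul_of_nonneg_left (h1.trans h2) (sq_nonneg z)]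

theorem tendsto_div_cube_of_hasDerivAt {u g : ℝ → ℝ} {r L : ℝ} (hr : 0 < r)
    (hu : ∀ x ∈ Ioo 0 r, HasDerivAt u (x ^ 2 * g x) x) (hu0 : Tendsto u (𝓝[>] 0) (𝓝 0))
    (hg : Tendsto g (𝓝[>] 0) (𝓝 L)) : Tendsto (fun x => u x / x ^ 3) (𝓝[>] 0) (𝓝 (L / 3)) := by
  have hcube : ∀ x ∈ Ioo 0 r, HasDerivAt (fun y : ℝ => y ^ 3) (3 * x ^ 2) x := fun x _ => by
    simpa using hasDerivAt_pow 3 x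
  refine HasDerivAt.lhopital_zero_right_on_Ioo hr hu hcube
    (fun x hx => by have := hx.1; positivity) hu0 ?_ ?_
  · exact ((continuous_pow 3).tendsto' 0 0 (by simp)).mono_left nhdsWithin_le_nhds
  · refine (hg.div_const 3).congr' ?_
    filter_upwards [self_mem_nhdsWithin] with x hx
    have : x ≠ 0 := ne_of_gt hx
    field_simp

theorem tendsto_div_of_hasDerivAt {u g : ℝ → ℝ} {r L : ℝ} (hr : 0 < r)
    (hu : ∀ x ∈ Ioo 0 r, HasDerivAt u (g x) x) (hu0 : Tendsto u (𝓝[>] 0) (𝓝 0))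
    (hg : Tendsto g (𝓝[>] 0) (𝓝 L)) : Tendsto (fun x => u x / x) (𝓝[>] 0) (𝓝 L) :=
  HasDerivAt.lhopital_zero_right_on_Ioo hr hu (fun x _ => hasDerivAt_id x)
    (fun _ _ => one_ne_zero) hu0 (tendsto_id.mono_left nhdsWithin_le_nhds) (by simpa using hg)

/-- A function `u` with bounded derivative that is controlled by `f'` tends to `0` at a critical
point of `f`, even though `f'` is not assumed continuous there. -/
theorem tendsto_zero_of_abs_le_deriv {f u g : ℝ → ℝ} {r B M : ℝ} (hr : 0 < r)
    (hf : ContinuousOn f (Icc 0 r)) (hf0 : HasDerivWithinAt f 0 (Icc 0 r) 0)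
    (hfd : ∀ x ∈ Ioo 0 r, DifferentiableAt ℝ f x)
    (hu : ∀ x ∈ Ioo 0 r, HasDerivAt u (g x) x) (hg : ∀ x ∈ Ioo 0 r, |g x| ≤ B)
    (huf : ∀ x ∈ Ioo 0 r, |u x| ≤ M * |deriv f x|) : Tendsto u (𝓝[>] 0) (𝓝 0) := by
  have hslope : Tendsto (slope f 0) (𝓝[>] 0) (𝓝 0) := by
    have h : HasDerivWithinAt f 0 (Ioi 0) 0 := hf0.mono_of_mem_nhdsWithin
      (mem_of_superset (Ioo_mem_nhdsGT hr) Ioo_subset_Icc_self)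
    rwa [hasDerivWithinAt_iff_tendsto_slope' self_notMem_Ioi] at h
  have hid : Tendsto (fun x : ℝ => x) (𝓝[>] 0) (𝓝 0) := tendsto_id.mono_left nhdsWithin_le_nhds
  refine squeeze_zero_norm' (a := fun y => M * |slope f 0 y| + B * y) ?_
    (by simpa using (hslope.abs.const_mul M).add (hid.const_mul B))
  filter_upwards [Ioo_mem_nhdsGT hr] with y hy
  obtain ⟨ξ, hξ, hξe⟩ := exists_deriv_eq_slope' f hy.1
    (hf.mono (Icc_subset_Icc_right hy.2.le))
    (fun x hx => (hfd x ⟨hx.1, hx.2.trans hy.2⟩).differentiableWithinAt)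
  have hξr : ξ ∈ Ioo 0 r := ⟨hξ.1, hξ.2.trans hy.2⟩
  have h1 := huf ξ hξr
  have h2 := (convex_Ioo 0 r).norm_image_sub_le_of_norm_hasDerivWithin_le
    (fun x hx => (hu x hx).hasDerivWithinAt) hg hξr hy
  rw [hξe] at h1
  have hB : 0 ≤ B := (abs_nonneg _).trans (hg y hy)
  have h3 : B * ‖y - ξ‖ ≤ B * y := by
    rw [Real.norm_of_nonneg (by linarith [hξ.2])]
    exact mul_le_mul_of_nonneg_left (by linarith [hξ.1]) hB
  have h4 : ‖u y‖ ≤ ‖u ξ‖ + ‖u y - u ξ‖ := by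
    simpa using norm_add_le (u ξ) (u y - u ξ)
  have h5 : ‖u ξ‖ = |u ξ| := rfl
  linarith

/-- The nonlinear part of the desingularised system in the variables
`(f - a)/x`, `(C - α)/x`, `f'/(x C)`, `(1 - A)/x²`, as a function of `x` and of these variables
multiplied by `x`. -/
def bosonSource (a α : ℝ) (z : ℝ × ℝ × ℝ × ℝ × ℝ) : ℝ × ℝ × ℝ × ℝ :=
  ((α + z.2.2.1) * z.2.2.2.1,
    (z.1 * (α + z.2.2.1) * (a + z.2.1) ^ 2 - (α + z.2.2.1) * z.2.2.2.2)
      / (1 - z.1 * z.2.2.2.2),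
    (a + z.2.1) * (1 - (1 - z.1 * z.2.2.2.2) * (α + z.2.2.1) ^ 2)
      / ((1 - z.1 * z.2.2.2.2) * (α + z.2.2.1)),
    (1 - z.1 * z.2.2.2.2) * (α + z.2.2.1) ^ 2 * z.2.2.2.1 ^ 2
      + (1 - z.1 * z.2.2.2.2) * (α + z.2.2.1) ^ 2 * (a + z.2.1) ^ 2 + (a + z.2.1) ^ 2)

/-- The field `H` for which the desingularised system reads `x w' = H(x, w) - 3 w`. -/
def bosonField (a α x : ℝ) (w : ℝ × ℝ × ℝ × ℝ) : ℝ × ℝ × ℝ × ℝ :=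
  (2 : ℝ) • (w.1, w.2.1, (0 : ℝ), (0 : ℝ)) + bosonSource a α (x, x • w)

theorem contDiffAt_bosonSource {a α : ℝ} {z : ℝ × ℝ × ℝ × ℝ × ℝ}
    (hA : 1 - z.1 * z.2.2.2.2 ≠ 0) (hC : α + z.2.2.1 ≠ 0) :
    ContDiffAt ℝ 1 (bosonSource a α) z := by
  unfold bosonSource
  have hAC := mul_ne_zero hA hC
  fun_prop (disch := assumption)

theorem contDiffAt_bosonField {a α x : ℝ} {w : ℝ × ℝ × ℝ × ℝ}
    (hA : 1 - x * (x * w.2.2.2) ≠ 0) (hC : α + x * w.2.1 ≠ 0) :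
    ContDiffAt ℝ 1 (Function.uncurry (bosonField a α)) (x, w) := by
  have hS : ContDiffAt ℝ 1 (bosonSource a α) (x, x • w) := contDiffAt_bosonSource hA hC
  have hcomp : ContDiffAt ℝ 1
      (fun p : ℝ × ℝ × ℝ × ℝ × ℝ => bosonSource a α (p.1, p.1 • p.2)) (x, w) :=
    ContDiffAt.comp (x, w) (f := fun p : ℝ × ℝ × ℝ × ℝ × ℝ => (p.1, p.1 • p.2)) hS (by fun_prop)
  have hlin : ContDiffAt ℝ 1
      (fun p : ℝ × ℝ × ℝ × ℝ × ℝ => (2 : ℝ) • (p.2.1, p.2.2.1, (0 : ℝ), (0 : ℝ))) (x, w) := by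
    fun_prop
  exact hlin.add hcomp

theorem norm_fst_snd_zero_le (w : ℝ × ℝ × ℝ × ℝ) : ‖(w.1, w.2.1, (0 : ℝ), (0 : ℝ))‖ ≤ ‖w‖ := by
  simp only [Prod.norm_def, norm_zero]
  grind

theorem exists_bosonField_estimates (a : ℝ) {α R : ℝ} (hα : 0 < α) (hR : 0 ≤ R) :
    ∃ δ > 0,
      ContinuousOn (Function.uncurry (bosonField a α)) (Icc 0 δ ×ˢ Metric.closedBall 0 R) ∧
      (∀ x ∈ Icc 0 δ, ∀ u ∈ Metric.closedBall (0 : ℝ × ℝ × ℝ × ℝ) R,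
        ∀ v ∈ Metric.closedBall (0 : ℝ × ℝ × ℝ × ℝ) R,
        ‖bosonField a α x u - bosonField a α x v‖ ≤ 5 / 2 * ‖u - v‖) ∧
      ∀ x ∈ Icc 0 δ, ∀ u ∈ Metric.closedBall (0 : ℝ × ℝ × ℝ × ℝ) R,
        ‖bosonField a α x u‖ ≤ 2 * R + (‖bosonSource a α 0‖ + 1) := by
  obtain ⟨K, t, ht, hK⟩ := (contDiffAt_bosonSource (a := a) (z := 0) (by simp)
    (by simpa using hα.ne')).exists_lipschitzOnWith
  have hgood : ∀ᶠ z : ℝ × ℝ × ℝ × ℝ × ℝ in 𝓝 0,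
      z ∈ t ∧ 1 - z.1 * z.2.2.2.2 ≠ 0 ∧ α + z.2.2.1 ≠ 0 := by
    refine (eventually_mem_set.2 ht).and (.and ?_ ?_)
    · exact ContinuousAt.eventually_ne (by fun_prop) (by simp)
    · exact ContinuousAt.eventually_ne (by fun_prop) (by simpa using hα.ne')
  obtain ⟨ε, hε, hball⟩ := Metric.eventually_nhds_iff_ball.1 hgood
  obtain ⟨δ, ⟨hδ1, hδ2⟩, hδ⟩ : ∃ δ : ℝ, (δ * (1 + R) < ε ∧ K * (δ * (1 + R)) < 1 / 2) ∧ 0 < δ := by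
    have h1 : ∀ᶠ δ : ℝ in 𝓝[>] 0, δ * (1 + R) < ε := by
      refine nhdsWithin_le_nhds (ContinuousAt.eventually_lt (by fun_prop) (by fun_prop) ?_)
      simpa using hε
    have h2 : ∀ᶠ δ : ℝ in 𝓝[>] 0, K * (δ * (1 + R)) < 1 / 2 := by
      refine nhdsWithin_le_nhds (ContinuousAt.eventually_lt (by fun_prop) (by fun_prop) ?_)
      simp
    exact ((h1.and h2).and self_mem_nhdsWithin).exists
  have hnorm : ∀ x ∈ Icc 0 δ, ∀ u ∈ Metric.closedBall (0 : ℝ × ℝ × ℝ × ℝ) R,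
      ‖(x, x • u)‖ ≤ δ * (1 + R) := fun x hx u hu => by
    have hu' : ‖u‖ ≤ R := by simpa using hu
    rw [Prod.norm_def, norm_smul, Real.norm_of_nonneg hx.1]
    refine max_le ?_ ?_
    · nlinarith [hx.1, hx.2]
    · nlinarith [hx.1, hx.2, mul_le_mul hx.2 hu' (norm_nonneg u) hδ.le]
  have hmem : ∀ x ∈ Icc 0 δ, ∀ u ∈ Metric.closedBall (0 : ℝ × ℝ × ℝ × ℝ) R,
      (x, x • u) ∈ Metric.ball (0 : ℝ × ℝ × ℝ × ℝ × ℝ) ε := fun x hx u hu => by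
    rw [mem_ball_zero_iff]
    exact (hnorm x hx u hu).trans_lt hδ1
  refine ⟨δ, hδ, ?_, fun x hx u hu v hv => ?_, fun x hx u hu => ?_⟩
  · rintro ⟨x, u⟩ ⟨hx, hu⟩
    obtain ⟨-, hA, hC⟩ := hball _ (hmem x hx u hu)
    exact (contDiffAt_bosonField hA hC).continuousAt.continuousWithinAt
  · have h := hK.norm_sub_le (hball _ (hmem x hx u hu)).1 (hball _ (hmem x hx v hv)).1
    have e1 : ‖((x, x • u) : ℝ × ℝ × ℝ × ℝ × ℝ) - (x, x • v)‖ = x * ‖u - v‖ := by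
      rw [Prod.mk_sub_mk, ← smul_sub, sub_self, Prod.norm_def, norm_smul,
        Real.norm_of_nonneg hx.1, norm_zero]
      exact max_eq_right (mul_nonneg hx.1 (norm_nonneg _))
    rw [e1] at h
    have e2 : bosonField a α x u - bosonField a α x v
        = (2 : ℝ) • ((u - v).1, (u - v).2.1, (0 : ℝ), (0 : ℝ))
          + (bosonSource a α (x, x • u) - bosonSource a α (x, x • v)) := by
      simp only [bosonField, add_sub_add_comm, ← smul_sub, Prod.mk_sub_mk, sub_zero, Prod.fst_sub,
        Prod.snd_sub]
    have h2 := norm_add_le ((2 : ℝ) • ((u - v).1, (u - v).2.1, (0 : ℝ), (0 : ℝ)))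
      (bosonSource a α (x, x • u) - bosonSource a α (x, x • v))
    rw [← e2, norm_smul, Real.norm_two] at h2
    have h3 := norm_fst_snd_zero_le (u - v)
    have hKx : K * x ≤ 1 / 2 := by
      have : x ≤ δ * (1 + R) := by nlinarith [hx.2]
      exact (mul_le_mul_of_nonneg_left this K.coe_nonneg).trans hδ2.le
    have h4 := mul_le_mul_of_nonneg_right hKx (norm_nonneg (u - v))
    linarith
  · have hu' : ‖u‖ ≤ R := by simpa using hu
    have h := hK.norm_sub_le (hball _ (hmem x hx u hu)).1 (mem_of_mem_nhds ht)
    rw [sub_zero] at h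
    have h1 := mul_le_mul_of_nonneg_left (hnorm x hx u hu) K.coe_nonneg
    have h2 := norm_add_le ((2 : ℝ) • (u.1, u.2.1, (0 : ℝ), (0 : ℝ))) (bosonSource a α (x, x • u))
    rw [norm_smul, Real.norm_two] at h2
    have h3 := norm_fst_snd_zero_le u
    have h4 := norm_le_norm_add_norm_sub' (bosonSource a α (x, x • u)) (bosonSource a α 0)
    change ‖bosonField a α x u‖ ≤ _ at h2
    linarith

theorem exists_isLocalSolution (a : ℝ) {α : ℝ} (hα : 0 < α) :
    ∃ r > (0 : ℝ), ∃ f A C : ℝ → ℝ, IsLocalSolution f A C a α r := by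
  obtain ⟨δ, hδ, hcont, hlip, hbd⟩ :=
    exists_bosonField_estimates a hα (R := ‖bosonSource a α 0‖ + 1) (by positivity)
  obtain ⟨w, hw, hw0, hwd⟩ := exists_solution_singular_ode hδ (by positivity)
    (by norm_num) (by norm_num) hcont hlip
    (fun x hx u hu => (hbd x hx u hu).trans_eq (by ring))
  have hφ0 : (w 0).1 = 0 := by
    have h := congrArg Prod.fst hw0
    simp [bosonField, bosonSource] at h
    linarith
  have hpos : ∀ᶠ x in 𝓝 (0 : ℝ), 0 < 1 - x * (x * (w x).2.2.2) ∧ 0 < α + x * (w x).2.1 := by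
    refine .and ?_ ?_
    · exact continuousAt_const.eventually_lt (by fun_prop) (by simp)
    · exact continuousAt_const.eventually_lt (by fun_prop) (by simpa using hα)
  obtain ⟨ρ, hρ, hρpos⟩ := Metric.eventually_nhds_iff_ball.1 hpos
  have hr : 0 < min δ ρ / 2 := by positivity
  have hsub : ∀ x ∈ Ioc 0 (min δ ρ / 2), x ∈ Ioo 0 (min δ ρ) := fun x hx =>
    ⟨hx.1, by linarith [hx.2]⟩
  have hAC : ∀ x ∈ Ioo 0 (min δ ρ), 0 < 1 - x * (x * (w x).2.2.2) ∧ 0 < α + x * (w x).2.1 :=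
    fun x hx => hρpos x (by
      rw [mem_ball_zero_iff, Real.norm_of_nonneg hx.1.le]
      exact hx.2.trans_le (min_le_right _ _))
  have hd : ∀ x ∈ Ioo 0 (min δ ρ), HasDerivAt w (x⁻¹ • (bosonField a α x (w x) - (3 : ℝ) • w x)) x :=
    fun x hx => hwd x ⟨hx.1, hx.2.trans_le (min_le_left _ _)⟩
  generalize min δ ρ = σ at *
  set f : ℝ → ℝ := fun x => a + x * (w x).1 with hf
  set C : ℝ → ℝ := fun x => α + x * (w x).2.1 with hC
  set A : ℝ → ℝ := fun x => 1 - x * (x * (w x).2.2.2) with hA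
  have hfd : ∀ x ∈ Ioo 0 σ, HasDerivAt f (x * C x * (w x).2.2.1) x := fun x hx => by
    have hx0 := hx.1.ne'
    refine (((hasDerivAt_id' x).fun_mul (hd x hx).fst).const_add a).congr_deriv ?_
    simp [bosonField, bosonSource, hC]
    field_simp
    ring
  have hCd : ∀ x ∈ Ioo 0 σ, HasDerivAt C (C x / (x * A x) * (A x - 1 + x ^ 2 * f x ^ 2)) x :=
    fun x hx => by
      have hx0 := hx.1.ne'
      have hA0 := (hAC x hx).1.ne'
      refine (((hasDerivAt_id' x).fun_mul (hd x hx).snd.fst).const_add α).congr_deriv ?_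
      simp only [bosonField, bosonSource, hC, hA, hf, Prod.fst_add, Prod.snd_add, Prod.fst_sub,
        Prod.snd_sub, Prod.smul_fst, Prod.smul_snd, smul_eq_mul] at hA0 ⊢
      field_simp
      ring
  have hpd : ∀ x ∈ Ioo 0 σ, HasDerivAt (fun x => (w x).2.2.1)
      (x⁻¹ * (f x * (1 - A x * C x ^ 2) / (A x * C x) - 3 * (w x).2.2.1)) x := fun x hx => by
    have h : HasDerivAt (fun x => (w x).2.2.1) _ x := (hd x hx).snd.snd.fst
    refine h.congr_deriv ?_
    simp [bosonField, bosonSource, hC, hA, hf]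
  have hqd : ∀ x ∈ Ioo 0 σ, HasDerivAt A ((1 - A x) / x
      - x * (A x * deriv f x ^ 2 + A x * C x ^ 2 * f x ^ 2 + f x ^ 2)) x := fun x hx => by
    have hx0 := hx.1.ne'
    rw [(hfd x hx).deriv]
    refine (((hasDerivAt_id' x).fun_mul ((hasDerivAt_id' x).fun_mul
      (hd x hx).snd.snd.snd)).const_sub 1).congr_deriv ?_
    simp only [bosonField, bosonSource, hC, hA, hf, Prod.snd_add, Prod.snd_sub,
      Prod.smul_fst, Prod.smul_snd, smul_eq_mul]
    field_simp
    ring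
  have hf' : ∀ x ∈ Ioo 0 σ, deriv f =ᶠ[𝓝 x] fun y => y * C y * (w y).2.2.1 := fun x hx => by
    filter_upwards [Ioo_mem_nhds hx.1 hx.2] with y hy using (hfd y hy).deriv
  refine ⟨σ / 2, hr, f, A, C, fun x hx => ?_, ?_, ?_, ?_, ?_, ?_, ?_, ?_⟩
  · have hx := hsub x hx
    refine ⟨hx.1, (hAC x hx).1, (hAC x hx).2, (hfd x hx).differentiableAt, ?_,
      (hqd x hx).differentiableAt, (hCd x hx).differentiableAt, ?_, (hqd x hx).deriv,
      (hCd x hx).deriv⟩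
    · refine DifferentiableAt.congr_of_eventuallyEq ?_ (hf' x hx)
      exact (differentiableAt_id.mul (hCd x hx).differentiableAt).mul (hpd x hx).differentiableAt
    · have hu : (fun y => y ^ 2 * deriv f y / C y) =ᶠ[𝓝 x] fun y => y ^ 3 * (w y).2.2.1 := by
        filter_upwards [Ioo_mem_nhds hx.1 hx.2] with y hy
        have hy0 : C y ≠ 0 := (hAC y hy).2.ne'
        rw [(hfd y hy).deriv]
        field_simp
      rw [hu.deriv_eq, ((hasDerivAt_pow 3 x).fun_mul (hpd x hx)).deriv]
      have hx0 := hx.1.ne'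
      have hA0 : A x ≠ 0 := (hAC x hx).1.ne'
      have hC0 : C x ≠ 0 := (hAC x hx).2.ne'
      field_simp
      push_cast
      ring
  · exact Continuous.continuousOn (by fun_prop)
  · exact Continuous.continuousOn (by fun_prop)
  · exact Continuous.continuousOn (by fun_prop)
  · have h := (hasDerivWithinAt_id_smul (s := Icc 0 (σ / 2))
      (g := fun x => (w x).1) (by fun_prop)).const_add a
    rwa [hφ0] at h
  · simp [hf]
  · simp [hA]
  · simp [hC]

/-- The desingularised variables `(f - a)/x`, `(C - α)/x`, `f'/(x C)`, `(1 - A)/x²`. -/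
def bosonState (f A C : ℝ → ℝ) (a α x : ℝ) : ℝ × ℝ × ℝ × ℝ :=
  ((f x - a) / x, (C x - α) / x, x ^ 2 * deriv f x / C x / x ^ 3, x * (1 - A x) / x ^ 3)

theorem hasDerivAt_mass {A : ℝ → ℝ} {x B : ℝ} (hx : x ≠ 0)
    (h : HasDerivAt A ((1 - A x) / x - x * B) x) :
    HasDerivAt (fun y => y * (1 - A y)) (x ^ 2 * B) x := by
  refine ((hasDerivAt_id' x).fun_mul (h.const_sub 1)).congr_deriv ?_
  field_simp
  ring

theorem hasDerivAt_bosonState {f A C : ℝ → ℝ} {a α x : ℝ} {s : Set ℝ}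
    (h : MiniBosonSystem f A C s) (hx : x ∈ s) :
    HasDerivAt (bosonState f A C a α)
      (x⁻¹ • (bosonField a α x (bosonState f A C a α x) - (3 : ℝ) • bosonState f A C a α x)) x := by
  obtain ⟨hx0, hA0, hC0, hf, hf', hA, hC, eu, eA, eC⟩ := h x hx
  have hx0 := hx0.ne'
  have hA0 := hA0.ne'
  have hC0 := hC0.ne'
  have hu : HasDerivAt (fun y => y ^ 2 * deriv f y / C y)
      (x ^ 2 / (A x * C x) * (1 - A x * C x ^ 2) * f x) x := by
    rw [← eu]
    exact DifferentiableAt.hasDerivAt (by fun_prop (disch := assumption))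
  have hm := hasDerivAt_mass hx0 (eA ▸ hA.hasDerivAt)
  have hcube := hasDerivAt_pow 3 x
  have hx3 : x ^ 3 ≠ 0 := pow_ne_zero 3 hx0
  have hAe : 1 - x * (x * (x * (1 - A x) / x ^ 3)) = A x := by field_simp; ring
  have hCe : α + x * ((C x - α) / x) = C x := by field_simp; ring
  have hfe : a + x * ((f x - a) / x) = f x := by field_simp; ring
  refine (((hf.hasDerivAt.sub_const a).fun_div (hasDerivAt_id' x) hx0).prodMk
    (((hC.hasDerivAt.sub_const α).fun_div (hasDerivAt_id' x) hx0).prodMk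
      ((hu.fun_div hcube hx3).prodMk (hm.fun_div hcube hx3)))).congr_deriv ?_
  simp only [bosonField, bosonSource, bosonState, Prod.smul_mk, Prod.mk_add_mk, Prod.mk_sub_mk,
    smul_eq_mul, hAe, hCe, hfe, eC, Prod.mk.injEq]
  refine ⟨?_, ?_, ?_, ?_⟩ <;> field_simp <;> push_cast <;> ring

theorem IsLocalSolution.tendsto_bosonState {f A C : ℝ → ℝ} {a α r : ℝ} (hα : 0 < α) (hr : 0 < r)
    (h : IsLocalSolution f A C a α r) :
    Tendsto (bosonState f A C a α) (𝓝[>] 0)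
      (𝓝 (0, 0, a * (1 - α ^ 2) / α / 3, (α ^ 2 * a ^ 2 + a ^ 2) / 3)) := by
  obtain ⟨hsys, hfc, hAc, hCc, hf0, rfl, hA0, rfl⟩ := h
  have hIcc : Icc 0 r ∈ 𝓝[>] (0 : ℝ) := mem_of_superset (Ioo_mem_nhdsGT hr) Ioo_subset_Icc_self
  have hmem : (0 : ℝ) ∈ Icc 0 r := ⟨le_rfl, hr.le⟩
  have tf : Tendsto f (𝓝[>] 0) (𝓝 (f 0)) := (hfc 0 hmem).mono_of_mem_nhdsWithin hIcc
  have tA : Tendsto A (𝓝[>] 0) (𝓝 1) := hA0 ▸ (hAc 0 hmem).mono_of_mem_nhdsWithin hIcc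
  have tC : Tendsto C (𝓝[>] 0) (𝓝 (C 0)) := (hCc 0 hmem).mono_of_mem_nhdsWithin hIcc
  have tx : Tendsto (fun x : ℝ => x) (𝓝[>] 0) (𝓝 0) := tendsto_id.mono_left nhdsWithin_le_nhds
  have tg : Tendsto (fun x => (1 - A x * C x ^ 2) * f x / (A x * C x)) (𝓝[>] 0)
      (𝓝 (f 0 * (1 - C 0 ^ 2) / C 0)) := by
    have := ((tendsto_const_nhds (x := (1 : ℝ))).sub (tA.mul (tC.pow 2))).mul tf |>.div
      (tA.mul tC) (by simpa using hα.ne')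
    rw [one_mul, one_mul, mul_comm _ (f 0)] at this
    exact this
  have hud : ∀ x ∈ Ioo 0 r, HasDerivAt (fun y => y ^ 2 * deriv f y / C y)
      (x ^ 2 * ((1 - A x * C x ^ 2) * f x / (A x * C x))) x := fun x hx => by
    obtain ⟨hx0, hA0, hC0, hf, hf', hA, hC, eu, eA, eC⟩ := hsys x ⟨hx.1, hx.2.le⟩
    have hC0 := hC0.ne'
    refine (DifferentiableAt.hasDerivAt (by fun_prop (disch := assumption))).congr_deriv ?_
    rw [eu]
    ring
  have tu : Tendsto (fun y => y ^ 2 * deriv f y / C y) (𝓝[>] 0) (𝓝 0) := by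
    have hb : ∀ᶠ x in 𝓝[>] (0 : ℝ),
        |x ^ 2 * ((1 - A x * C x ^ 2) * f x / (A x * C x))| < 1 ∧ |x ^ 2 / C x| < 1 ∧ x < r := by
      refine .and ?_ (.and ?_ (mem_of_superset (Ioo_mem_nhdsGT hr) fun x hx => hx.2))
      · exact ((tx.pow 2).mul tg).abs.eventually_lt_const (by simp)
      · exact ((tx.pow 2).div tC hα.ne').abs.eventually_lt_const (by simp)
    obtain ⟨r', hr', hsub⟩ := mem_nhdsGT_iff_exists_Ioo_subset.1 hb
    have hr'r : r' ≤ r := by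
      by_contra! hlt
      exact lt_irrefl r (hsub ⟨hr, hlt⟩).2.2
    refine tendsto_zero_of_abs_le_deriv (f := f) (B := 1) (M := 1) hr'
      (hfc.mono (Icc_subset_Icc_right hr'r)) (hf0.mono (Icc_subset_Icc_right hr'r))
      (fun x hx => (hsys x ⟨hx.1, hx.2.le.trans hr'r⟩).2.2.2.1)
      (fun x hx => hud x ⟨hx.1, hx.2.trans_le hr'r⟩) (fun x hx => (hsub hx).1.le) fun x hx => ?_
    rw [mul_div_right_comm, abs_mul]
    exact mul_le_mul_of_nonneg_right (hsub hx).2.1.le (abs_nonneg _)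
  have tp := tendsto_div_cube_of_hasDerivAt hr hud tu tg
  have tf' : Tendsto (deriv f) (𝓝[>] 0) (𝓝 0) := by
    have := (tx.mul tC).mul tp
    simp only [zero_mul] at this
    refine this.congr' ?_
    filter_upwards [Ioo_mem_nhdsGT hr] with x hx
    obtain ⟨hx0, -, hC0, -⟩ := hsys x ⟨hx.1, hx.2.le⟩
    have := hx0.ne'
    have := hC0.ne'
    field_simp
  have hmd : ∀ x ∈ Ioo 0 r, HasDerivAt (fun y => y * (1 - A y))
      (x ^ 2 * (A x * deriv f x ^ 2 + A x * C x ^ 2 * f x ^ 2 + f x ^ 2)) x := fun x hx => by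
    obtain ⟨hx0, -, -, -, -, hA, -, -, eA, -⟩ := hsys x ⟨hx.1, hx.2.le⟩
    exact hasDerivAt_mass hx0.ne' (eA ▸ hA.hasDerivAt)
  have tq := tendsto_div_cube_of_hasDerivAt (L := C 0 ^ 2 * f 0 ^ 2 + f 0 ^ 2) hr hmd
    (by simpa using tx.mul ((tendsto_const_nhds (x := (1 : ℝ))).sub tA))
    (by simpa using ((tA.mul (tf'.pow 2)).add ((tA.mul (tC.pow 2)).mul (tf.pow 2))).add (tf.pow 2))
  have hfd : ∀ x ∈ Ioo 0 r, HasDerivAt (fun y => f y - f 0) (deriv f x) x := fun x hx =>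
    (hsys x ⟨hx.1, hx.2.le⟩).2.2.2.1.hasDerivAt.sub_const _
  have tφ := tendsto_div_of_hasDerivAt hr hfd (by simpa using tf.sub_const (f 0)) tf'
  have hCd : ∀ x ∈ Ioo 0 r, HasDerivAt (fun y => C y - C 0)
      (x * C x / A x * (f x ^ 2 - x * (1 - A x) / x ^ 3)) x := fun x hx => by
    obtain ⟨hx0, hA0, -, -, -, -, hC, -, -, eC⟩ := hsys x ⟨hx.1, hx.2.le⟩
    refine (hC.hasDerivAt.sub_const _).congr_deriv ?_
    have := hx0.ne'
    have := hA0.ne'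
    rw [eC]
    field_simp
    ring
  have tγ := tendsto_div_of_hasDerivAt hr hCd (by simpa using tC.sub_const (C 0))
    (((tx.mul tC).div tA one_ne_zero).mul ((tf.pow 2).sub tq))
  simp only [zero_mul, zero_div] at tγ
  exact tφ.prodMk_nhds (tγ.prodMk_nhds (tp.prodMk_nhds tq))

theorem bosonState_zero (f A C : ℝ → ℝ) (a α : ℝ) : bosonState f A C a α 0 = 0 := by
  simp [bosonState]

theorem IsLocalSolution.bosonState_eq {f₁ A₁ C₁ f₂ A₂ C₂ : ℝ → ℝ} {a α r : ℝ} (hα : 0 < α)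
    (hr : 0 < r) (h₁ : IsLocalSolution f₁ A₁ C₁ a α r) (h₂ : IsLocalSolution f₂ A₂ C₂ a α r) :
    ∀ x ∈ Icc 0 r, bosonState f₁ A₁ C₁ a α x = bosonState f₂ A₂ C₂ a α x := by
  have t₁ := h₁.tendsto_bosonState hα hr
  have t₂ := h₂.tendsto_bosonState hα hr
  have d₁ := fun x (hx : x ∈ Ioc 0 r) => hasDerivAt_bosonState (a := a) (α := α) h₁.1 hx
  have d₂ := fun x (hx : x ∈ Ioc 0 r) => hasDerivAt_bosonState (a := a) (α := α) h₂.1 hx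
  have z₁ := bosonState_zero f₁ A₁ C₁ a α
  have z₂ := bosonState_zero f₂ A₂ C₂ a α
  have hne : ∀ x ∈ Ioc 0 r, 1 - x * (x * (bosonState f₁ A₁ C₁ a α x).2.2.2) ≠ 0 ∧
      α + x * (bosonState f₁ A₁ C₁ a α x).2.1 ≠ 0 := fun x hx => by
    obtain ⟨hx0, hA, hC, -⟩ := h₁.1 x hx
    have hx0 := hx0.ne'
    have e1 : 1 - x * (x * (x * (1 - A₁ x) / x ^ 3)) = A₁ x := by field_simp; ring
    have e2 : α + x * ((C₁ x - α) / x) = C₁ x := by field_simp; ring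
    simp only [bosonState, e1, e2]
    exact ⟨hA.ne', hC.ne'⟩
  generalize bosonState f₁ A₁ C₁ a α = W₁ at *
  generalize bosonState f₂ A₂ C₂ a α = W₂ at *
  set w₀ : ℝ × ℝ × ℝ × ℝ := (0, 0, a * (1 - α ^ 2) / α / 3, (α ^ 2 * a ^ 2 + a ^ 2) / 3)
  have hD : ContinuousOn (fun x => W₁ x - W₂ x) (Icc 0 r) := by
    intro x hx
    rcases hx.1.eq_or_lt with rfl | hx0
    · have : ContinuousWithinAt (fun x => W₁ x - W₂ x) (Ioi 0) 0 := by
        have := t₁.sub t₂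
        rw [sub_self] at this
        simpa [ContinuousWithinAt, z₁, z₂] using this
      exact (continuousWithinAt_Ioi_iff_Ici.1 this).mono fun y hy => hy.1
    · exact ((d₁ x ⟨hx0, hx.2⟩).continuousAt.sub
        (d₂ x ⟨hx0, hx.2⟩).continuousAt).continuousWithinAt
  obtain ⟨δ, hδ, -, hlip, -⟩ :=
    exists_bosonField_estimates a hα (R := ‖w₀‖ + 1) (by positivity)
  have hb : ∀ᶠ x in 𝓝[>] (0 : ℝ), ‖W₁ x‖ < ‖w₀‖ + 1 ∧ ‖W₂ x‖ < ‖w₀‖ + 1 :=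
    (t₁.norm.eventually_lt_const (lt_add_one _)).and (t₂.norm.eventually_lt_const (lt_add_one _))
  obtain ⟨ρ, hρ, hρs⟩ := mem_nhdsGT_iff_exists_Ioo_subset.1 hb
  have hρ : 0 < ρ := hρ
  obtain ⟨σ, hσ, hσδ, hσρ, hσr⟩ : ∃ σ > 0, σ ≤ δ ∧ σ ≤ ρ ∧ σ ≤ r :=
    ⟨min δ (min ρ r), by positivity, by simp, by simp, by simp⟩
  have hzero := eq_zero_of_singular_ode (D := fun x => W₁ x - W₂ x)
    (g := fun x => bosonField a α x (W₁ x) - bosonField a α x (W₂ x)) (δ := σ) (k := 5 / 2)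
    (by norm_num) (by norm_num) (hD.mono (Icc_subset_Icc_right hσr)) (by simp [z₁, z₂])
    (fun x hx => by
      have hx' : x ∈ Ioc 0 r := ⟨hx.1, hx.2.le.trans hσr⟩
      refine ((d₁ x hx').sub (d₂ x hx')).congr_deriv ?_
      module)
    (fun x hx => by
      obtain ⟨b₁, b₂⟩ := hρs ⟨hx.1, hx.2.trans_le hσρ⟩
      exact hlip x ⟨hx.1.le, hx.2.le.trans hσδ⟩ _ (by simpa using b₁.le) _ (by simpa using b₂.le))
  refine IsClosed.Icc_subset_of_forall_mem_nhdsWithin (s := {x | W₁ x = W₂ x}) ?_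
    (z₁.trans z₂.symm) ?_
  · have := hD.preimage_isClosed_of_isClosed isClosed_Icc (isClosed_singleton (x := 0))
    convert this using 1
    ext x
    simp [sub_eq_zero, and_comm]
  · rintro x ⟨hxe, hx⟩
    rcases hx.1.eq_or_lt with rfl | hx0
    · exact mem_of_superset (Ioo_mem_nhdsGT hσ) fun y hy =>
        sub_eq_zero.1 (hzero y ⟨hy.1.le, hy.2.le⟩)
    have hxr : x ∈ Ioc 0 r := ⟨hx0, hx.2.le⟩
    have hV : ContDiffAt ℝ 1 (fun p : ℝ × ℝ × ℝ × ℝ × ℝ =>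
        p.1⁻¹ • (bosonField a α p.1 p.2 - (3 : ℝ) • p.2)) (x, W₁ x) :=
      (contDiffAt_fst.inv hx0.ne').smul
        ((contDiffAt_bosonField (hne x hxr).1 (hne x hxr).2).sub
          (contDiffAt_snd.const_smul (3 : ℝ)))
    obtain ⟨K, n, hn, hK⟩ := hV.exists_lipschitzOnWith
    have hev : ∀ᶠ t in 𝓝 x, t ∈ Ioc 0 r :=
      mem_of_superset (Ioo_mem_nhds hx0 hx.2) Ioo_subset_Ioc_self
    have hsol : ∀ W : ℝ → ℝ × ℝ × ℝ × ℝ, (∀ t ∈ Ioc 0 r,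
        HasDerivAt W (t⁻¹ • (bosonField a α t (W t) - (3 : ℝ) • W t)) t) → W x = W₁ x →
        ∀ᶠ t in 𝓝 x, HasDerivAt W (t⁻¹ • (bosonField a α t (W t) - (3 : ℝ) • W t)) t ∧
          W t ∈ {w | (t, w) ∈ n} := fun W hW hWx => by
      have hc : ContinuousAt (fun t => (t, W t)) x := continuousAt_id.prodMk (hW x hxr).continuousAt
      filter_upwards [hev, hc.preimage_mem_nhds (hWx ▸ hn)] with t ht ht' using ⟨hW t ht, ht'⟩
    refine nhdsWithin_le_nhds (ODE_solution_unique_of_eventually (K := K)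
      (v := fun t w => t⁻¹ • (bosonField a α t w - (3 : ℝ) • w)) (s := fun t => {w | (t, w) ∈ n})
      (Eventually.of_forall fun t => ?_) (hsol W₁ d₁ rfl) (hsol W₂ d₂ hxe.symm) hxe)
    exact LipschitzOnWith.of_dist_le_mul fun u hu v hv => by
      simpa [dist_prod_same_left] using hK.dist_le_mul (t, u) hu (t, v) hv

/-- Local existence and uniqueness: for every `a > 0`, `α > 0` there is
`r > 0` and a solution of the mini-boson-star system on `[0, r]` with
`f 0 = a`, `f' 0 = 0`, `A 0 = 1`, `C 0 = α`; moreover any two such local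
solutions agree on `[0, r]`. -/
theorem local_existence_uniqueness (a α : ℝ) (ha : 0 < a) (hα : 0 < α) :
    ∃ r > (0 : ℝ),
      (∃ f A C : ℝ → ℝ, IsLocalSolution f A C a α r) ∧
      ∀ f₁ A₁ C₁ f₂ A₂ C₂ : ℝ → ℝ,
        IsLocalSolution f₁ A₁ C₁ a α r → IsLocalSolution f₂ A₂ C₂ a α r →
        ∀ x ∈ Set.Icc (0 : ℝ) r, f₁ x = f₂ x ∧ A₁ x = A₂ x ∧ C₁ x = C₂ x := by
  obtain ⟨r, hr, hsol⟩ := exists_isLocalSolution a hα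
  refine ⟨r, hr, hsol, fun f₁ A₁ C₁ f₂ A₂ C₂ h₁ h₂ x hx => ?_⟩
  rcases hx.1.eq_or_lt with rfl | hx0
  · obtain ⟨-, -, -, -, -, hf₁, hA₁, hC₁⟩ := h₁
    obtain ⟨-, -, -, -, -, hf₂, hA₂, hC₂⟩ := h₂
    exact ⟨hf₁.trans hf₂.symm, hA₁.trans hA₂.symm, hC₁.trans hC₂.symm⟩
  · have h := h₁.bosonState_eq hα hr h₂ x hx
    simpa [bosonState, hx0.ne', div_left_inj'] using And.intro (congrArg Prod.fst h)
      (And.intro (congrArg (fun w => w.2.2.2) h) (congrArg (fun w => w.2.1) h))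
end
end

section
/- Fix α > 1 and let (A, C) be a maximal solution of the limiting system with A(0) = 1, C(0) = α. Then the solution crashes at a finite point ȳ with 1 < ȳ < √3: A(y) > 0 for 0 ≤ y < ȳ and lim_{y→ȳ⁻} A(y) = 0. -/
open Real Set Filter Topology MeasureTheory

noncomputable section

/-- The limiting system (large central amplitude limit of the mini-boson-star
system) for `A, C` on a set `s ⊆ (0, ∞)` (prime denotes `d/dy`):
`A' = (1 − A)/y − y·(1 + A C²)`, `C' = (C/(y A))·(A − 1 + y²)`,
with `A > 0` and `C > 0`. -/
def LimitSystem (A C : ℝ → ℝ) (s : Set ℝ) : Prop :=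
  ∀ y ∈ s, 0 < y ∧ 0 < A y ∧ 0 < C y ∧
    DifferentiableAt ℝ A y ∧ DifferentiableAt ℝ C y ∧
    deriv A y = (1 - A y) / y - y * (1 + A y * C y ^ 2) ∧
    deriv C y = C y / (y * A y) * (A y - 1 + y ^ 2)

/-- A solution of the limiting system on the domain `s = [0, ȳ)`, continuous up
to `y = 0`, with `A 0 = 1` and `C 0 = α`. -/
def IsLimitOrbit (A C : ℝ → ℝ) (α : ℝ) (s : Set ℝ) : Prop :=
  IsOrbitDomain s ∧
  LimitSystem A C (s \ {0}) ∧
  ContinuousWithinAt A s 0 ∧ ContinuousWithinAt C s 0 ∧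
  A 0 = 1 ∧ C 0 = α

lemma antitoneOn_Ioo_of_hasDerivAt_nonpos {f f' : ℝ → ℝ} {a b : ℝ}
    (hf : ∀ x ∈ Ioo a b, HasDerivAt f (f' x) x) (hf' : ∀ x ∈ Ioo a b, f' x ≤ 0) :
    AntitoneOn f (Ioo a b) := by
  refine antitoneOn_of_hasDerivWithinAt_nonpos (f' := f') (convex_Ioo a b)
    (fun x hx => (hf x hx).continuousAt.continuousWithinAt) ?_ ?_ <;> rw [interior_Ioo]
  exacts [fun x hx => (hf x hx).hasDerivWithinAt, hf']

lemma monotoneOn_Ioo_of_hasDerivAt_nonneg {f f' : ℝ → ℝ} {a b : ℝ}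
    (hf : ∀ x ∈ Ioo a b, HasDerivAt f (f' x) x) (hf' : ∀ x ∈ Ioo a b, 0 ≤ f' x) :
    MonotoneOn f (Ioo a b) := by
  refine monotoneOn_of_hasDerivWithinAt_nonneg (f' := f') (convex_Ioo a b)
    (fun x hx => (hf x hx).continuousAt.continuousWithinAt) ?_ ?_ <;> rw [interior_Ioo]
  exacts [fun x hx => (hf x hx).hasDerivWithinAt, hf']

lemma Filter.Eventually.exists_forall_mem_Ioo {p : ℝ → Prop} {b : ℝ} (hb : 0 < b)
    (hp : ∀ᶠ y in 𝓝[<] b, p y) : ∃ a, 0 ≤ a ∧ a < b ∧ ∀ y ∈ Ioo a b, p y := by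
  obtain ⟨a, hab, ha⟩ := (mem_nhdsLT_iff_exists_Ioo_subset' hb).1 hp
  exact ⟨max a 0, le_max_right _ _, max_lt hab hb,
    fun y hy => ha ⟨(le_max_left _ _).trans_lt hy.1, hy.2⟩⟩

/-- Gluing two differentiable functions whose values and derivatives match at the junction. -/
lemma hasDerivAt_ite_lt {f f' g : ℝ → ℝ} {a b e : ℝ} (hab : a < b)
    (hf : ∀ x ∈ Ioo a b, HasDerivAt f (f' x) x) (hlim : Tendsto f (𝓝[<] b) (𝓝 (g b)))
    (hlim' : Tendsto f' (𝓝[<] b) (𝓝 e)) (hg : HasDerivAt g e b) :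
    HasDerivAt (fun y => if y < b then f y else g y) e b := by
  set F : ℝ → ℝ := fun y => if y < b then f y else g y
  have hF : ∀ x ∈ Ioo a b, HasDerivAt F (f' x) x := fun x hx =>
    (hf x hx).congr_of_eventuallyEq <| by
      filter_upwards [Iio_mem_nhds hx.2] with y hy using if_pos hy
  have hFb : F b = g b := if_neg (lt_irrefl b)
  have hIoo : Ioo a b ∈ 𝓝[<] b := Ioo_mem_nhdsLT hab
  have left : HasDerivWithinAt F e (Iic b) b := by
    refine hasDerivWithinAt_Iic_of_tendsto_deriv (s := Ioo a b)
      (fun x hx => (hF x hx).differentiableAt.differentiableWithinAt) ?_ hIoo ?_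
    · rw [ContinuousWithinAt, hFb]
      refine ((hlim.mono_left (nhdsWithin_mono _ Ioo_subset_Iio_self))).congr' ?_
      filter_upwards [self_mem_nhdsWithin] with y hy using (if_pos hy.2).symm
    · refine hlim'.congr' ?_
      filter_upwards [hIoo] with y hy using (hF y hy).deriv.symm
  have right : HasDerivWithinAt F e (Ici b) b :=
    hg.hasDerivWithinAt.congr (fun y hy => if_neg (not_lt.2 hy)) hFb
  simpa using left.union right

namespace LimitSystem

variable {A C : ℝ → ℝ} {b : ℝ}

lemma hasDerivAt_fst {s : Set ℝ} (h : LimitSystem A C s) {y : ℝ} (hy : y ∈ s) :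
    HasDerivAt A ((1 - A y) / y - y * (1 + A y * C y ^ 2)) y := by
  obtain ⟨-, -, -, hA, -, hA', -⟩ := h y hy
  exact hA' ▸ hA.hasDerivAt

lemma hasDerivAt_snd {s : Set ℝ} (h : LimitSystem A C s) {y : ℝ} (hy : y ∈ s) :
    HasDerivAt C (C y / (y * A y) * (A y - 1 + y ^ 2)) y := by
  obtain ⟨-, -, -, -, hC, -, hC'⟩ := h y hy
  exact hC' ▸ hC.hasDerivAt

lemma of_hasDerivAt {s : Set ℝ} (h : ∀ y ∈ s, 0 < y ∧ 0 < A y ∧ 0 < C y ∧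
    HasDerivAt A ((1 - A y) / y - y * (1 + A y * C y ^ 2)) y ∧
    HasDerivAt C (C y / (y * A y) * (A y - 1 + y ^ 2)) y) : LimitSystem A C s := fun y hy =>
  have ⟨h0, hA, hC, hA', hC'⟩ := h y hy
  ⟨h0, hA, hC, hA'.differentiableAt, hC'.differentiableAt, hA'.deriv, hC'.deriv⟩

lemma mono {s t : Set ℝ} (h : LimitSystem A C t) (hst : s ⊆ t) : LimitSystem A C s :=
  fun y hy => h y (hst hy)

/-- Local existence: the Picard–Lindelöf theorem for the limiting system. -/
lemma exists_local {L M : ℝ} (hb : 0 < b) (hL : 0 < L) (hM : 0 < M) :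
    ∃ P Q : ℝ → ℝ, P b = L ∧ Q b = M ∧
      ∃ ε > 0, LimitSystem P Q (Ioo (b - ε) (b + ε)) := by
  let V : ℝ × ℝ × ℝ → ℝ × ℝ × ℝ := fun p =>
    (1, (1 - p.2.1) / p.1 - p.1 * (1 + p.2.1 * p.2.2 ^ 2),
      p.2.2 / (p.1 * p.2.1) * (p.2.1 - 1 + p.1 ^ 2))
  have hV : ContDiffAt ℝ 1 V (b, L, M) := by
    have h1 : ContDiffAt ℝ 1 (fun p : ℝ × ℝ × ℝ => p.1) (b, L, M) := contDiffAt_fst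
    have h2 : ContDiffAt ℝ 1 (fun p : ℝ × ℝ × ℝ => p.2.1) (b, L, M) :=
      contDiff_snd.fst.contDiffAt
    have h3 : ContDiffAt ℝ 1 (fun p : ℝ × ℝ × ℝ => p.2.2) (b, L, M) :=
      contDiff_snd.snd.contDiffAt
    refine contDiffAt_const.prodMk (ContDiffAt.prodMk ?_ ?_)
    · exact ((contDiffAt_const.sub h2).div h1 hb.ne').sub
        (h1.mul (contDiffAt_const.add (h2.mul (h3.pow 2))))
    · exact (h3.div (h1.mul h2) (mul_pos hb hL).ne').mul ((h2.sub contDiffAt_const).add (h1.pow 2))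
  obtain ⟨φ, hφb, ε, hε, hφ⟩ :=
    hV.exists_forall_mem_closedBall_exists_eq_forall_mem_Ioo_hasDerivAt₀ b
  have hb_mem : b ∈ Ioo (b - ε) (b + ε) := ⟨by linarith, by linarith⟩
  have hfst : ∀ t ∈ Ioo (b - ε) (b + ε), HasDerivAt (fun t => (φ t).1) 1 t :=
    fun t ht => (hφ t ht).fst
  have htime : ∀ t ∈ Ioo (b - ε) (b + ε), (φ t).1 = t := by
    have hd : ∀ t ∈ Ioo (b - ε) (b + ε), HasDerivAt (fun t => (φ t).1 - t) 0 t := fun t ht =>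
      ((hfst t ht).sub (hasDerivAt_id t)).congr_deriv (sub_self 1)
    intro t ht
    have hconst := isOpen_Ioo.is_const_of_deriv_eq_zero (f := fun t => (φ t).1 - t)
      isPreconnected_Ioo
      (fun t ht => (hd t ht).differentiableAt.differentiableWithinAt)
      (fun t ht => (hd t ht).deriv) ht hb_mem
    simp only [hφb, sub_self] at hconst
    linarith
  have hcont : ContinuousAt φ b := (hφ b hb_mem).continuousAt
  have hpos : ∀ᶠ t in 𝓝 b, 0 < t ∧ 0 < (φ t).2.1 ∧ 0 < (φ t).2.2 := by
    refine (lt_mem_nhds hb).and (Eventually.and ?_ ?_)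
    · exact hcont.snd.fst.eventually (lt_mem_nhds (by simpa [hφb] using hL))
    · exact hcont.snd.snd.eventually (lt_mem_nhds (by simpa [hφb] using hM))
  obtain ⟨δ, hδ, hball⟩ := Metric.eventually_nhds_iff_ball.1 hpos
  rw [Real.ball_eq_Ioo] at hball
  refine ⟨fun t => (φ t).2.1, fun t => (φ t).2.2, by simp [hφb], by simp [hφb], min ε δ,
    lt_min hε hδ, of_hasDerivAt fun t ht => ?_⟩
  have ht₁ : t ∈ Ioo (b - ε) (b + ε) :=
    ⟨by linarith [ht.1, min_le_left ε δ], by linarith [ht.2, min_le_left ε δ]⟩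
  have ht₂ : t ∈ Ioo (b - δ) (b + δ) :=
    ⟨by linarith [ht.1, min_le_right ε δ], by linarith [ht.2, min_le_right ε δ]⟩
  obtain ⟨h0, hA, hC⟩ := hball t ht₂
  have h := (hφ t ht₁).snd
  simp only [V, htime t ht₁] at h
  exact ⟨h0, hA, hC, h.fst, h.snd⟩

/-- A solution with positive limits at the right end `b` extends beyond `b`. -/
lemma exists_extension {L M : ℝ} (h : LimitSystem A C (Ioo 0 b)) (hb : 0 < b)
    (hL : 0 < L) (hM : 0 < M) (hA : Tendsto A (𝓝[<] b) (𝓝 L)) (hC : Tendsto C (𝓝[<] b) (𝓝 M)) :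
    ∃ A' C' : ℝ → ℝ, ∃ b' > b, LimitSystem A' C' (Ioo 0 b') ∧
      EqOn A A' (Iio b) ∧ EqOn C C' (Iio b) := by
  obtain ⟨P, Q, hP, hQ, ε, hε, hPQ⟩ := exists_local hb hL hM
  have hid : Tendsto (fun y : ℝ => y) (𝓝[<] b) (𝓝 b) := tendsto_id.mono_left nhdsWithin_le_nhds
  have hb_mem : b ∈ Ioo (b - ε) (b + ε) := ⟨by linarith, by linarith⟩
  have hAb := hPQ.hasDerivAt_fst hb_mem
  have hCb := hPQ.hasDerivAt_snd hb_mem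
  rw [hP, hQ] at hAb hCb
  have hAlim : Tendsto (fun y => (1 - A y) / y - y * (1 + A y * C y ^ 2)) (𝓝[<] b)
      (𝓝 ((1 - L) / b - b * (1 + L * M ^ 2))) :=
    ((tendsto_const_nhds.sub hA).div hid hb.ne').sub
      (hid.mul (tendsto_const_nhds.add (hA.mul (hC.pow 2))))
  have hClim : Tendsto (fun y => C y / (y * A y) * (A y - 1 + y ^ 2)) (𝓝[<] b)
      (𝓝 (M / (b * L) * (L - 1 + b ^ 2))) :=
    (hC.div (hid.mul hA) (mul_pos hb hL).ne').mul ((hA.sub tendsto_const_nhds).add (hid.pow 2))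
  refine ⟨fun y => if y < b then A y else P y, fun y => if y < b then C y else Q y, b + ε,
    by linarith, of_hasDerivAt fun y hy => ⟨hy.1, ?_⟩, fun y hy => (if_pos hy).symm,
    fun y hy => (if_pos hy).symm⟩
  rcases lt_trichotomy y b with hyb | rfl | hyb
  · have hy' : y ∈ Ioo 0 b := ⟨hy.1, hyb⟩
    obtain ⟨-, hAy, hCy, -⟩ := h y hy'
    have hev : ∀ᶠ z in 𝓝 y, z < b := Iio_mem_nhds hyb
    simp only [if_pos hyb]
    exact ⟨hAy, hCy,
      (h.hasDerivAt_fst hy').congr_of_eventuallyEq (hev.mono fun z hz => if_pos hz),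
      (h.hasDerivAt_snd hy').congr_of_eventuallyEq (hev.mono fun z hz => if_pos hz)⟩
  · simp only [lt_irrefl, if_false, hP, hQ]
    exact ⟨hL, hM,
      hasDerivAt_ite_lt hb (fun x hx => h.hasDerivAt_fst hx) (by rwa [hP]) hAlim hAb,
      hasDerivAt_ite_lt hb (fun x hx => h.hasDerivAt_snd hx) (by rwa [hQ]) hClim hCb⟩
  · have hy' : y ∈ Ioo (b - ε) (b + ε) := ⟨by linarith, hy.2⟩
    obtain ⟨-, hAy, hCy, -⟩ := hPQ y hy'
    have hev : ∀ᶠ z in 𝓝 y, b < z := Ioi_mem_nhds hyb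
    simp only [if_neg hyb.not_gt]
    exact ⟨hAy, hCy,
      (hPQ.hasDerivAt_fst hy').congr_of_eventuallyEq (hev.mono fun z hz => if_neg hz.not_gt),
      (hPQ.hasDerivAt_snd hy').congr_of_eventuallyEq (hev.mono fun z hz => if_neg hz.not_gt)⟩

lemma hasDerivAt_mul (h : LimitSystem A C (Ioo 0 b)) {y : ℝ} (hy : y ∈ Ioo 0 b) :
    HasDerivAt (fun y => A y * C y) (-(y * (A y * C y) * C y ^ 2)) y := by
  obtain ⟨h0, hA, -⟩ := h y hy
  refine ((h.hasDerivAt_fst hy).mul (h.hasDerivAt_snd hy)).congr_deriv ?_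
  have := h0.ne'
  field_simp
  ring

lemma hasDerivAt_mul_sq (h : LimitSystem A C (Ioo 0 b)) {y : ℝ} (hy : y ∈ Ioo 0 b) :
    HasDerivAt (fun y => A y * C y ^ 2)
      (A y * C y ^ 2 * (A y - 1 + y ^ 2 - y ^ 2 * (A y * C y ^ 2)) / (y * A y)) y := by
  obtain ⟨h0, hA, -⟩ := h y hy
  refine ((h.hasDerivAt_fst hy).mul ((h.hasDerivAt_snd hy).pow 2)).congr_deriv ?_
  have := h0.ne'
  field_simp
  simp
  ring

lemma hasDerivAt_id_mul (h : LimitSystem A C (Ioo 0 b)) {y : ℝ} (hy : y ∈ Ioo 0 b) :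
    HasDerivAt (fun y => y * A y) (1 - y ^ 2 - y ^ 2 * (A y * C y ^ 2)) y := by
  obtain ⟨h0, -⟩ := h y hy
  refine ((hasDerivAt_id y).mul (h.hasDerivAt_fst hy)).congr_deriv ?_
  have := h0.ne'
  simp only [id]
  field_simp
  ring

lemma hasDerivAt_id_mul_sub (h : LimitSystem A C (Ioo 0 b)) {y : ℝ} (hy : y ∈ Ioo 0 b) :
    HasDerivAt (fun y => y * A y - y + y ^ 3 / 3) (-(y ^ 2 * (A y * C y ^ 2))) y := by
  refine (((h.hasDerivAt_id_mul hy).sub (hasDerivAt_id y)).add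
    ((hasDerivAt_pow 3 y).div_const 3)).congr_deriv ?_
  norm_num
  ring

/-- `y A` lies strictly below `y − y³/3`, so a solution cannot reach `√3`. -/
lemma sq_lt_three (h : LimitSystem A C (Ioo 0 b)) (hb : 0 < b)
    (hA : ContinuousWithinAt A (Ico 0 b) 0) : b ^ 2 < 3 := by
  set E : ℝ → ℝ := fun y => y * A y - y + y ^ 3 / 3
  have hanti : StrictAntiOn E (Ico 0 b) := by
    refine strictAntiOn_of_deriv_neg (convex_Ico 0 b) (fun y hy => ?_) (fun y hy => ?_)
    · rcases hy.1.eq_or_lt with rfl | h0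
      · exact ((continuousWithinAt_id.mul hA).sub continuousWithinAt_id).add
          ((continuousWithinAt_id.pow 3).div_const 3)
      · exact (h.hasDerivAt_id_mul_sub ⟨h0, hy.2⟩).continuousAt.continuousWithinAt
    · rw [interior_Ico] at hy
      obtain ⟨h0, hAy, hCy, -⟩ := h y hy
      rw [(h.hasDerivAt_id_mul_sub hy).deriv, neg_lt_zero]
      positivity
  have hmid : E (b / 2) < 0 := by
    have := hanti (a := 0) ⟨le_rfl, hb⟩ (b := b / 2) ⟨by linarith, by linarith⟩ (by linarith)
    simpa [E] using this
  have hlim : Tendsto (fun y : ℝ => -y + y ^ 3 / 3) (𝓝[<] b) (𝓝 (-b + b ^ 3 / 3)) := by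
    have : Continuous fun y : ℝ => -y + y ^ 3 / 3 := by fun_prop
    exact this.continuousAt.tendsto.mono_left nhdsWithin_le_nhds
  have hle : -b + b ^ 3 / 3 ≤ E (b / 2) := by
    refine le_of_tendsto hlim ?_
    filter_upwards [Ioo_mem_nhdsLT (half_lt_self hb)] with y hy
    have h0 : 0 < y := by linarith [hy.1]
    obtain ⟨-, hAy, -⟩ := h y ⟨h0, hy.2⟩
    have := hanti (a := b / 2) ⟨by linarith, by linarith⟩ (b := y) ⟨h0.le, hy.2⟩ hy.1
    have := mul_pos h0 hAy
    simp only [E] at *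
    linarith
  by_contra! h3
  nlinarith

lemma exists_tendsto_fst (h : LimitSystem A C (Ioo 0 b)) (hb : 0 < b) :
    ∃ L, Tendsto A (𝓝[<] b) (𝓝 L) := by
  have hanti := antitoneOn_Ioo_of_hasDerivAt_nonpos (fun y hy => h.hasDerivAt_id_mul_sub hy)
    (fun y hy => by
      obtain ⟨h0, hA, hC, -⟩ := h y hy
      rw [neg_nonpos]; positivity)
  have hlim := hanti.tendsto_nhdsWithin_Ioo_left (nonempty_Ioo.2 hb) ⟨-b, by
    rintro _ ⟨y, hy, rfl⟩
    obtain ⟨h0, hA, -⟩ := h y hy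
    have := mul_pos h0 hA
    have := pow_pos h0 3
    linarith [hy.2]⟩
  have hid : Tendsto (fun y : ℝ => y) (𝓝[<] b) (𝓝 b) := tendsto_id.mono_left nhdsWithin_le_nhds
  refine ⟨_, (((hlim.add hid).sub ((hid.pow 3).div_const 3)).div hid hb.ne').congr' ?_⟩
  filter_upwards [Ioo_mem_nhdsLT hb] with y hy
  have := hy.1.ne'
  simp only [Pi.div_apply]
  field_simp
  ring

lemma antitoneOn_mul (h : LimitSystem A C (Ioo 0 b)) :
    AntitoneOn (fun y => A y * C y) (Ioo 0 b) :=
  antitoneOn_Ioo_of_hasDerivAt_nonpos (fun y hy => h.hasDerivAt_mul hy) (fun y hy => by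
    obtain ⟨h0, hA, hC, -⟩ := h y hy
    rw [neg_nonpos]; positivity)

/-- `A C` stays away from zero as long as `C` is bounded. -/
lemma eventually_le_mul {K : ℝ} (h : LimitSystem A C (Ioo 0 b)) (hb : 0 < b)
    (hK : ∀ᶠ y in 𝓝[<] b, C y ≤ K) : ∃ c > 0, ∀ᶠ y in 𝓝[<] b, c ≤ A y * C y := by
  obtain ⟨a, ha, hab, hKa⟩ := hK.exists_forall_mem_Ioo hb
  have hsub : Ioo a b ⊆ Ioo 0 b := Ioo_subset_Ioo_left ha
  have hmono := monotoneOn_Ioo_of_hasDerivAt_nonneg (a := a) (b := b)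
    (f := fun y => A y * C y * exp (b * K ^ 2 * y))
    (fun y hy => (h.hasDerivAt_mul (hsub hy)).mul
      (((hasDerivAt_id y).const_mul (b * K ^ 2)).exp)) (fun y hy => by
      obtain ⟨h0, hA, hC, -⟩ := h y (hsub hy)
      have hsq : C y ^ 2 ≤ K ^ 2 := pow_le_pow_left₀ hC.le (hKa y hy) 2
      have hle : y * C y ^ 2 ≤ b * K ^ 2 := by
        have := hy.2.le
        gcongr
      have : 0 ≤ A y * C y * exp (b * K ^ 2 * id y) * (b * K ^ 2 - y * C y ^ 2) :=
        mul_nonneg (by positivity) (by linarith)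
      simp only [id] at this ⊢
      linarith)
  set m := (a + b) / 2
  have hm : m ∈ Ioo a b := ⟨by simp only [m]; linarith, by simp only [m]; linarith⟩
  obtain ⟨h0, hAm, hCm, -⟩ := h m (hsub hm)
  refine ⟨A m * C m * exp (b * K ^ 2 * m) / exp (b * K ^ 2 * b), by positivity, ?_⟩
  filter_upwards [Ioo_mem_nhdsLT hm.2] with y hy
  have hya : y ∈ Ioo a b := ⟨hm.1.trans hy.1, hy.2⟩
  obtain ⟨-, hA, hC, -⟩ := h y (hsub hya)
  rw [div_le_iff₀ (exp_pos _)]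
  refine (hmono hm hya hy.1.le).trans ?_
  have := hy.2.le
  simp only
  gcongr

/-- If `A → 0` at `b`, then `C` is unbounded near `b`. -/
lemma not_eventually_le {K : ℝ} (h : LimitSystem A C (Ioo 0 b)) (hb : 0 < b)
    (hA : Tendsto A (𝓝[<] b) (𝓝 0)) : ¬ ∀ᶠ y in 𝓝[<] b, C y ≤ K := by
  intro hK
  obtain ⟨c, hc, hcA⟩ := h.eventually_le_mul hb hK
  have hlim : Tendsto (fun y => A y * K) (𝓝[<] b) (𝓝 0) := by simpa using hA.mul_const K
  refine hc.not_ge (ge_of_tendsto hlim ?_)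
  filter_upwards [hcA, hK, Ioo_mem_nhdsLT hb] with y hy hKy hmem
  exact hy.trans (mul_le_mul_of_nonneg_left hKy (h y hmem).2.1.le)

/-- A crash cannot happen at a point `b ≤ 1`. -/
lemma one_lt_of_tendsto_zero (h : LimitSystem A C (Ioo 0 b)) (hb : 0 < b)
    (hA : Tendsto A (𝓝[<] b) (𝓝 0)) : 1 < b := by
  by_contra! hb1
  obtain ⟨a, ha, hab, hAa⟩ := (hA.eventually (gt_mem_nhds one_half_pos)).exists_forall_mem_Ioo hb
  have hsub : Ioo a b ⊆ Ioo 0 b := Ioo_subset_Ioo_left ha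
  by_cases hB : ∀ y ∈ Ioo a b, 2 ≤ A y * C y ^ 2
  · have hq : ∀ y ∈ Ioo a b, A y - 1 + y ^ 2 - y ^ 2 * (A y * C y ^ 2) ≤ -(1 / 2) := fun y hy => by
      nlinarith [hAa y hy, hB y hy, sq_nonneg y]
    have hanti := antitoneOn_Ioo_of_hasDerivAt_nonpos
      (fun y hy => h.hasDerivAt_mul_sq (hsub hy)) (fun y hy => by
        obtain ⟨h0, hAy, hCy, -⟩ := h y (hsub hy)
        refine div_nonpos_of_nonpos_of_nonneg (mul_nonpos_of_nonneg_of_nonpos ?_ ?_) ?_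
        · positivity
        · linarith [hq y hy]
        · positivity)
    have hmono := monotoneOn_Ioo_of_hasDerivAt_nonneg (a := a) (b := b)
      (f := fun y => (A y * C y) ^ 2 * exp (-4 * (A y * C y ^ 2)))
      (fun y hy => ((h.hasDerivAt_mul (hsub hy)).pow 2).mul
        (((h.hasDerivAt_mul_sq (hsub hy)).const_mul (-4)).exp)) (fun y hy => by
        obtain ⟨h0, hAy, hCy, -⟩ := h y (hsub hy)
        have hy1 : y ≤ 1 := hy.2.le.trans hb1
        have hkey : 0 ≤ -2 * y ^ 2
            - 4 * (A y - 1 + y ^ 2 - y ^ 2 * (A y * C y ^ 2)) := by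
          nlinarith [hq y hy]
        have : 0 ≤ exp (-4 * (A y * C y ^ 2)) * (A y ^ 2 * C y ^ 4 / y) * (-2 * y ^ 2
            - 4 * (A y - 1 + y ^ 2 - y ^ 2 * (A y * C y ^ 2))) :=
          mul_nonneg (by positivity) hkey
        refine this.trans_eq ?_
        have := h0.ne'
        field_simp
        simp
        ring)
    set m := (a + b) / 2
    have hm : m ∈ Ioo a b := ⟨by simp only [m]; linarith, by simp only [m]; linarith⟩
    obtain ⟨h0, hAm, hCm, -⟩ := h m (hsub hm)
    have hlim : Tendsto (fun y => A y * (A m * C m ^ 2)) (𝓝[<] b) (𝓝 0) := by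
      simpa using hA.mul_const (A m * C m ^ 2)
    have hpos : 0 < (A m * C m) ^ 2 * exp (-4 * (A m * C m ^ 2)) := by positivity
    refine hpos.not_ge (ge_of_tendsto hlim ?_)
    filter_upwards [Ioo_mem_nhdsLT hm.2] with y hy
    have hya : y ∈ Ioo a b := ⟨hm.1.trans hy.1, hy.2⟩
    obtain ⟨-, hAy, hCy, -⟩ := h y (hsub hya)
    calc (A m * C m) ^ 2 * exp (-4 * (A m * C m ^ 2))
        ≤ (A y * C y) ^ 2 * exp (-4 * (A y * C y ^ 2)) := hmono hm hya hy.1.le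
      _ ≤ (A y * C y) ^ 2 * 1 := by
          gcongr
          rw [exp_le_one_iff]
          have : 0 < A y * C y ^ 2 := by positivity
          linarith
      _ = A y * (A y * C y ^ 2) := by ring
      _ ≤ A y * (A m * C m ^ 2) := mul_le_mul_of_nonneg_left (hanti hm hya hy.1.le) hAy.le
  · push Not at hB
    obtain ⟨x, hx, hBx⟩ := hB
    have hxsub : Ioo x b ⊆ Ioo 0 b := Ioo_subset_Ioo_left (hsub hx).1.le
    have hB2 : ∀ y ∈ Ioo x b, A y * C y ^ 2 ≤ 2 := by
      intro y hy
      have hmem : ∀ z ∈ Icc x y, z ∈ Ioo a b := fun z hz =>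
        ⟨hx.1.trans_le hz.1, hz.2.trans_lt hy.2⟩
      refine image_le_of_deriv_right_lt_deriv_boundary (a := x) (b := y) (B := fun _ => 2)
        (f := fun y => A y * C y ^ 2)
        (fun z hz => (h.hasDerivAt_mul_sq (hsub (hmem z hz))).continuousAt.continuousWithinAt)
        (fun z hz => (h.hasDerivAt_mul_sq
          (hsub (hmem z (Ico_subset_Icc_self hz)))).hasDerivWithinAt)
        hBx.le (fun z => hasDerivAt_const z 2) ?_ (right_mem_Icc.2 hy.1.le)
      intro z hz hz2
      have hza := hmem z (Ico_subset_Icc_self hz)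
      obtain ⟨h0, hAz, hCz, -⟩ := h z (hsub hza)
      rw [hz2]
      refine div_neg_of_neg_of_pos ?_ (by positivity)
      nlinarith [hAa z hza]
    have hd : ∀ y ∈ Ioo x b, HasDerivAt (fun y => y * A y - y + y ^ 3)
        (y ^ 2 * (2 - A y * C y ^ 2)) y := fun y hy => by
      refine (((h.hasDerivAt_id_mul (hxsub hy)).sub (hasDerivAt_id y)).add
        (hasDerivAt_pow 3 y)).congr_deriv ?_
      norm_num
      ring
    have hmono := monotoneOn_Ioo_of_hasDerivAt_nonneg hd
      (fun y hy => mul_nonneg (sq_nonneg y) (by linarith [hB2 y hy]))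
    have hid : Tendsto (fun y : ℝ => y) (𝓝[<] b) (𝓝 b) :=
      tendsto_id.mono_left nhdsWithin_le_nhds
    have hlim : Tendsto (fun y => y * A y - y + y ^ 3) (𝓝[<] b) (𝓝 (b * 0 - b + b ^ 3)) :=
      ((hid.mul hA).sub hid).add (hid.pow 3)
    have hw : ∀ y ∈ Ioo x b, A y - 1 + y ^ 2 ≤ 0 := by
      intro y hy
      have hle : y * A y - y + y ^ 3 ≤ b * 0 - b + b ^ 3 := by
        refine ge_of_tendsto hlim ?_
        filter_upwards [Ioo_mem_nhdsLT hy.2] with z hz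
        exact hmono hy ⟨hy.1.trans hz.1, hz.2⟩ hz.1.le
      have hb3 : b * 0 - b + b ^ 3 ≤ 0 := by nlinarith [mul_nonneg hb.le hb.le]
      have h0 := (hxsub hy).1
      by_contra! hpos
      nlinarith [mul_pos h0 hpos]
    have hanti := antitoneOn_Ioo_of_hasDerivAt_nonpos
      (fun y hy => h.hasDerivAt_snd (hxsub hy)) (fun y hy => by
        obtain ⟨h0, hAy, hCy, -⟩ := h y (hxsub hy)
        exact mul_nonpos_of_nonneg_of_nonpos (by positivity) (hw y hy))
    set m := (x + b) / 2
    have hm : m ∈ Ioo x b := ⟨by simp only [m]; linarith [hx.2], by simp only [m]; linarith [hx.2]⟩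
    refine h.not_eventually_le (K := C m) hb hA ?_
    filter_upwards [Ioo_mem_nhdsLT hm.2] with y hy
    exact hanti hm ⟨hm.1.trans hy.1, hy.2⟩ hy.1.le

/-- If `A` does not tend to zero at `b`, the solution extends beyond `b`. -/
lemma exists_extension_of_not_tendsto_zero (h : LimitSystem A C (Ioo 0 b)) (hb : 0 < b)
    (hA : ¬ Tendsto A (𝓝[<] b) (𝓝 0)) :
    ∃ A' C' : ℝ → ℝ, ∃ b' > b, LimitSystem A' C' (Ioo 0 b') ∧
      EqOn A A' (Iio b) ∧ EqOn C C' (Iio b) := by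
  obtain ⟨L, hL⟩ := h.exists_tendsto_fst hb
  have hL0 : 0 < L := by
    refine lt_of_le_of_ne (ge_of_tendsto hL ?_) (fun h0 => hA (h0 ▸ hL))
    filter_upwards [Ioo_mem_nhdsLT hb] with y hy using (h y hy).2.1.le
  have hu := h.antitoneOn_mul.tendsto_nhdsWithin_Ioo_left (nonempty_Ioo.2 hb) ⟨0, by
    rintro _ ⟨y, hy, rfl⟩
    obtain ⟨-, hAy, hCy, -⟩ := h y hy
    positivity⟩
  set ℓ := sInf ((fun y => A y * C y) '' Ioo 0 b)
  have hC : Tendsto C (𝓝[<] b) (𝓝 (ℓ / L)) := by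
    refine (hu.div hL hL0.ne').congr' ?_
    filter_upwards [Ioo_mem_nhdsLT hb] with y hy
    have := (h y hy).2.1.ne'
    simp only [Pi.div_apply]
    field_simp
  obtain ⟨c, hc, hcu⟩ := h.eventually_le_mul hb
    ((hC.eventually (gt_mem_nhds (lt_add_one _))).mono fun _ => le_of_lt)
  exact h.exists_extension hb hL0 (div_pos (hc.trans_le (ge_of_tendsto hu hcu)) hL0) hL hC

end LimitSystem

/-- For `α > 1`, the maximal solution of the limiting system with `A 0 = 1`,
`C 0 = α` crashes at a finite point `ȳ` with `1 < ȳ < √3`: its domain is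
`[0, ȳ)` and `A → 0` as `y → ȳ⁻`. -/
theorem limit_system_crashes (α : ℝ) (hα : 1 < α) (A C : ℝ → ℝ) (s : Set ℝ)
    (horbit : IsLimitOrbit A C α s)
    (hmax : ∀ (A' C' : ℝ → ℝ) (s' : Set ℝ), IsLimitOrbit A' C' α s' →
      s ⊆ s' → Set.EqOn A A' s → Set.EqOn C C' s → s' = s) :
    ∃ ybar : ℝ, 1 < ybar ∧ ybar < Real.sqrt 3 ∧ s = Set.Ico 0 ybar ∧
      Filter.Tendsto A (nhdsWithin ybar (Set.Iio ybar)) (nhds 0) := by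
  obtain ⟨hdom, hsys, hA0, hC0, hA1, hCα⟩ := horbit
  rcases hdom with rfl | ⟨b, hb, rfl⟩
  · have h2 : LimitSystem A C (Ioo 0 2) :=
      hsys.mono fun y hy => ⟨hy.1.le, hy.1.ne'⟩
    have := h2.sq_lt_three two_pos (hA0.mono Ico_subset_Ici_self)
    norm_num at this
  · rw [Ico_sdiff_left] at hsys
    have hlim : Tendsto A (𝓝[<] b) (𝓝 0) := by
      by_contra hnot
      obtain ⟨A', C', b', hb', hsys', hAA', hCC'⟩ :=
        hsys.exists_extension_of_not_tendsto_zero hb hnot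
      have hnhds : ∀ {f g : ℝ → ℝ}, EqOn f g (Iio b) → ContinuousWithinAt f (Ico 0 b) 0 →
          ContinuousWithinAt g (Ico 0 b') 0 := fun {f g} hfg hf => by
        refine (hf.congr_of_eventuallyEq ?_ (hfg hb).symm).mono_of_mem_nhdsWithin ?_
        · filter_upwards [self_mem_nhdsWithin] with y hy using (hfg hy.2).symm
        · filter_upwards [self_mem_nhdsWithin, nhdsWithin_le_nhds (Iio_mem_nhds hb)]
            with y hy hyb using ⟨hy.1, hyb⟩
      have heq := hmax A' C' (Ico 0 b')
        ⟨Or.inr ⟨b', hb.trans hb', rfl⟩, by rwa [Ico_sdiff_left], hnhds hAA' hA0, hnhds hCC' hC0,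
          (hAA' hb).symm.trans hA1, (hCC' hb).symm.trans hCα⟩
        (Ico_subset_Ico_right hb'.le) (hAA'.mono fun y hy => hy.2) (hCC'.mono fun y hy => hy.2)
      have hmem : b ∈ Ico 0 b' := ⟨hb.le, hb'⟩
      rw [heq] at hmem
      exact lt_irrefl b hmem.2
    exact ⟨b, hsys.one_lt_of_tendsto_zero hb hlim, Real.lt_sqrt_of_sq_lt (hsys.sq_lt_three hb hA0),
      rfl, hlim⟩
end
end

section
/- Fix α > 1 and let (A, C) solve the limiting system on [0, ȳ) with A(0) = 1, C(0) = α, and define g(y) = 1 − A(y) C(y)². Then: (a) g satisfies g'(y) = (1 − A(y) − y² g(y))·C(y)²/y for 0 < y < ȳ; (b) if g(y₀) ≥ 0 for some y₀ < ȳ, then g(y) > 0 for all y₀ < y < ȳ; (c) g'(y) > 0 at every y in (0, ȳ) where g(y) ≤ 1/3. -/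
open Real Set Filter Topology MeasureTheory

noncomputable section

/-- Along a solution of the limiting system, `g = 1 − A C²` has derivative
`(1 − A − y² g) C²/y`. -/
theorem LimitSystem.hasDerivAt_g {A C : ℝ → ℝ} {s : Set ℝ} (h : LimitSystem A C s)
    {y : ℝ} (hy : y ∈ s) :
    HasDerivAt (fun z => 1 - A z * C z ^ 2)
      ((1 - A y - y ^ 2 * (1 - A y * C y ^ 2)) * C y ^ 2 / y) y := by
  obtain ⟨hy0, hA, hC, dA, dC, eA, eC⟩ := h y hy
  refine ((dA.hasDerivAt.mul (dC.hasDerivAt.pow 2)).const_sub 1).congr_deriv ?_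
  simp only [Pi.pow_apply, eA, eC]
  field_simp
  ring

/-- A solution of the limiting system starting from `A 0 = 1` satisfies
`1 − A > y²/3`. -/
theorem IsLimitOrbit.sq_div_three_lt {A C : ℝ → ℝ} {α ybar : ℝ}
    (h : IsLimitOrbit A C α (Set.Ico 0 ybar)) {y : ℝ} (hy : 0 < y) (hyb : y < ybar) :
    y ^ 2 / 3 < 1 - A y := by
  obtain ⟨-, hsys, cA, -, hA0, -⟩ := h
  have mem : ∀ z : ℝ, 0 < z → z ≤ y → z ∈ Set.Ico 0 ybar \ {0} := fun z h0 h1 =>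
    ⟨⟨h0.le, h1.trans_lt hyb⟩, h0.ne'⟩
  have contA : ContinuousOn A (Set.Icc 0 y) := by
    intro z hz
    rcases hz.1.eq_or_lt with rfl | hz0
    · exact cA.mono fun w hw => ⟨hw.1, hw.2.trans_lt hyb⟩
    · exact (hsys z (mem z hz0 hz.2)).2.2.2.1.continuousAt.continuousWithinAt
  have mono : StrictMonoOn (fun z => z * (1 - A z) - z ^ 3 / 3) (Set.Icc 0 y) := by
    refine strictMonoOn_of_deriv_pos (convex_Icc 0 y) (by fun_prop) fun z hz => ?_
    rw [interior_Icc] at hz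
    obtain ⟨hz0, hA, hC, dA, -, eA, -⟩ := hsys z (mem z hz.1 hz.2.le)
    have hd : HasDerivAt (fun z => z * (1 - A z) - z ^ 3 / 3) (z ^ 2 * (A z * C z ^ 2)) z := by
      refine (((hasDerivAt_id z).mul (dA.hasDerivAt.const_sub 1)).sub
        ((hasDerivAt_pow 3 z).div_const 3)).congr_deriv ?_
      simp only [id, eA]
      push_cast
      field_simp
      ring
    rw [hd.deriv]
    positivity
  have key := mono ⟨le_rfl, hy.le⟩ ⟨hy.le, le_rfl⟩ hy
  simp only [hA0] at key
  by_contra! hle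
  nlinarith [mul_le_mul_of_nonneg_left hle hy.le]

/-- A function with positive derivative at `t` takes values below `f t` on any
interval to the left of `t`. -/
theorem HasDerivAt.exists_lt_of_pos {f : ℝ → ℝ} {f' a t : ℝ} (hf : HasDerivAt f f' t)
    (hf' : 0 < f') (hat : a < t) : ∃ x ∈ Set.Ioo a t, f x < f t := by
  have hslope : ∀ᶠ x in 𝓝[<] t, 0 < slope f t x :=
    ((hasDerivAt_iff_tendsto_slope.mp hf).eventually (lt_mem_nhds hf')).filter_mono
      (nhdsWithin_mono t fun x hx => ne_of_lt hx)
  obtain ⟨x, hx, hxmem⟩ := (hslope.and (Ioo_mem_nhdsLT hat)).exists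
  refine ⟨x, hxmem, ?_⟩
  rw [slope_def_field] at hx
  rcases div_pos_iff.mp hx with h | h
  · linarith [hxmem.2, h.2]
  · linarith [h.1]

/-- For the function `g = 1 − A C²` along a solution of the limiting system on
`[0, ȳ)`: (a) `g' = (1 − A − y² g) C²/y`; (b) if `g y₀ ≥ 0` then `g > 0` on
`(y₀, ȳ)`; (c) `g' y > 0` wherever `g y ≤ 1/3`. -/
theorem limit_g_properties (α : ℝ) (hα : 1 < α) (A C : ℝ → ℝ) (ybar : ℝ)
    (hybar : 0 < ybar) (horbit : IsLimitOrbit A C α (Set.Ico 0 ybar)) :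
    (∀ y : ℝ, 0 < y → y < ybar →
      deriv (fun z => 1 - A z * C z ^ 2) y
        = (1 - A y - y ^ 2 * (1 - A y * C y ^ 2)) * C y ^ 2 / y) ∧
    (∀ y₀ ∈ Set.Ico (0 : ℝ) ybar, 0 ≤ 1 - A y₀ * C y₀ ^ 2 →
      ∀ y : ℝ, y₀ < y → y < ybar → 0 < 1 - A y * C y ^ 2) ∧
    (∀ y : ℝ, 0 < y → y < ybar → 1 - A y * C y ^ 2 ≤ 1 / 3 →
      0 < deriv (fun z => 1 - A z * C z ^ 2) y) := by
  have hsys := horbit.2.1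
  have mem : ∀ z : ℝ, 0 < z → z < ybar → z ∈ Set.Ico 0 ybar \ {0} := fun z h0 h1 =>
    ⟨⟨h0.le, h1⟩, h0.ne'⟩
  have hderiv := fun y h0 h1 => hsys.hasDerivAt_g (mem y h0 h1)
  have hpos : ∀ y : ℝ, 0 < y → y < ybar → 1 - A y * C y ^ 2 ≤ 1 / 3 →
      0 < (1 - A y - y ^ 2 * (1 - A y * C y ^ 2)) * C y ^ 2 / y := by
    intro y h0 h1 hg
    have hC := (hsys y (mem y h0 h1)).2.2.1
    have hN : 0 < 1 - A y - y ^ 2 * (1 - A y * C y ^ 2) := by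
      linarith [horbit.sq_div_three_lt h0 h1, mul_le_mul_of_nonneg_left hg (sq_nonneg y)]
    positivity
  refine ⟨fun y h0 h1 => (hderiv y h0 h1).deriv, ?_, fun y h0 h1 hg => ?_⟩
  · intro y₀ hy₀ hg₀ y hlt hyb
    have hy₀pos : 0 < y₀ := by
      refine hy₀.1.lt_of_ne fun h => ?_
      obtain ⟨-, -, -, -, hA0, hC0⟩ := horbit
      rw [← h, hA0, hC0] at hg₀
      nlinarith
    by_contra! hle
    have hcont : ContinuousOn (fun z => 1 - A z * C z ^ 2) (Set.Icc y₀ y) := fun z hz =>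
      (hderiv z (hy₀pos.trans_le hz.1) (hz.2.trans_lt hyb)).continuousAt.continuousWithinAt
    obtain ⟨m, hm, hmin⟩ := isCompact_Icc.exists_isMinOn (Set.nonempty_Icc.mpr hlt.le) hcont
    have hmin' : ∀ x ∈ Set.Icc y₀ y, 1 - A m * C m ^ 2 ≤ 1 - A x * C x ^ 2 := hmin
    have hmy := hmin' y ⟨hlt.le, le_rfl⟩
    obtain ⟨t, ht, hty, htm⟩ : ∃ t, y₀ < t ∧ t ≤ y ∧
        1 - A t * C t ^ 2 ≤ 1 - A m * C m ^ 2 := by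
      rcases hm.1.eq_or_lt with rfl | hlt'
      · exact ⟨y, hlt, le_rfl, hle.trans hg₀⟩
      · exact ⟨m, hlt', hm.2, le_rfl⟩
    have ht0 := hy₀pos.trans ht
    have htb := hty.trans_lt hyb
    obtain ⟨x, hx, hxt⟩ := (hderiv t ht0 htb).exists_lt_of_pos
      (hpos t ht0 htb (by linarith)) ht
    linarith [hmin' x ⟨hx.1.le, hx.2.le.trans hty⟩]
  · rw [(hderiv y h0 h1).deriv]
    exact hpos y h0 h1 hg
end
end

section
/- Fix α > 1 and let (A, C) solve the limiting system on [0, ȳ) with A(0) = 1, C(0) = α, let g(y) = 1 − A(y) C(y)², and define p(y) = 1 + y² g(y) − y². Then p(y) > 0 for every y in the domain with y² ≤ 3/2. -/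
open Real Set Filter Topology MeasureTheory

noncomputable section

/-- The system satisfied by `A` and `W = A C²` on `[0, b]` for a solution of the limiting system. -/
structure ReducedOrbit (A W : ℝ → ℝ) (b : ℝ) : Prop where
  pos_A : ∀ y ∈ Ioc 0 b, 0 < A y
  pos_W : ∀ y ∈ Icc 0 b, 0 < W y
  zero_A : A 0 = 1
  cont_A : ContinuousOn A (Icc 0 b)
  cont_W : ContinuousOn W (Icc 0 b)
  deriv_A : ∀ y ∈ Ioc 0 b, HasDerivAt A ((1 - A y - y ^ 2 - y ^ 2 * W y) / y) y
  deriv_W : ∀ y ∈ Ioc 0 b,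
    HasDerivAt W (W y * (A y - 1 + y ^ 2 - y ^ 2 * W y) / (y * A y)) y

namespace ReducedOrbit

variable {A W : ℝ → ℝ} {b : ℝ}

theorem mono (h : ReducedOrbit A W b) {c : ℝ} (hc : c ≤ b) : ReducedOrbit A W c where
  pos_A y hy := h.pos_A y ⟨hy.1, hy.2.trans hc⟩
  pos_W y hy := h.pos_W y ⟨hy.1, hy.2.trans hc⟩
  zero_A := h.zero_A
  cont_A := h.cont_A.mono (Icc_subset_Icc_right hc)
  cont_W := h.cont_W.mono (Icc_subset_Icc_right hc)
  deriv_A y hy := h.deriv_A y ⟨hy.1, hy.2.trans hc⟩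
  deriv_W y hy := h.deriv_W y ⟨hy.1, hy.2.trans hc⟩

theorem hasDerivAt_mass (h : ReducedOrbit A W b) (k : ℝ) {y : ℝ} (hy : y ∈ Ioc 0 b) :
    HasDerivAt (fun z => z * (1 - A z) - (1 + k) / 3 * z ^ 3) (y ^ 2 * (W y - k)) y := by
  have hne : y ≠ 0 := hy.1.ne'
  have := ((hasDerivAt_id y).mul ((h.deriv_A y hy).const_sub 1)).sub
    (((hasDerivAt_id y).pow 3).const_mul ((1 + k) / 3))
  refine this.congr_deriv ?_
  simp only [id]
  field_simp
  ring

theorem continuousOn_mass (h : ReducedOrbit A W b) (k : ℝ) :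
    ContinuousOn (fun z => z * (1 - A z) - (1 + k) / 3 * z ^ 3) (Icc 0 b) := by
  have := h.cont_A
  fun_prop

/-- A lower bound `k` for `W` gives an upper bound for `A`. -/
theorem A_le (h : ReducedOrbit A W b) (hb : 0 < b) {k : ℝ} (hk : ∀ y ∈ Ioo 0 b, k ≤ W y) :
    A b ≤ 1 - (1 + k) / 3 * b ^ 2 := by
  have hm : MonotoneOn (fun z => z * (1 - A z) - (1 + k) / 3 * z ^ 3) (Icc 0 b) := by
    refine monotoneOn_of_deriv_nonneg (convex_Icc 0 b) (h.continuousOn_mass k) ?_ ?_ <;>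
      rw [interior_Icc]
    · exact fun y hy => (h.hasDerivAt_mass k
        (Ioo_subset_Ioc_self hy)).differentiableAt.differentiableWithinAt
    · intro y hy
      rw [(h.hasDerivAt_mass k (Ioo_subset_Ioc_self hy)).deriv]
      exact mul_nonneg (sq_nonneg y) (sub_nonneg.2 (hk y hy))
  have := hm (left_mem_Icc.2 hb.le) (right_mem_Icc.2 hb.le) hb.le
  simp only at this
  refine le_of_mul_le_mul_left ?_ hb
  linarith

theorem A_lt (h : ReducedOrbit A W b) (hb : 0 < b) {k : ℝ} (hk : ∀ y ∈ Ioo 0 b, k < W y) :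
    A b < 1 - (1 + k) / 3 * b ^ 2 := by
  have hm : StrictMonoOn (fun z => z * (1 - A z) - (1 + k) / 3 * z ^ 3) (Icc 0 b) := by
    refine strictMonoOn_of_deriv_pos (convex_Icc 0 b) (h.continuousOn_mass k) ?_
    rw [interior_Icc]
    intro y hy
    rw [(h.hasDerivAt_mass k (Ioo_subset_Ioc_self hy)).deriv]
    exact mul_pos (pow_pos hy.1 2) (sub_pos.2 (hk y hy))
  have := hm (left_mem_Icc.2 hb.le) (right_mem_Icc.2 hb.le) hb
  simp only at this
  refine lt_of_mul_lt_mul_left ?_ hb.le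
  linarith

/-- If `W` stays above `1/2` and ends strictly above it, then it is strictly decreasing. -/
theorem strictAntiOn_W (h : ReducedOrbit A W b) (hb : 0 < b)
    (hW : ∀ y ∈ Icc 0 b, 1 / 2 ≤ W y) (hWb : 1 / 2 < W b) : StrictAntiOn W (Icc 0 b) := by
  have hA : ∀ y ∈ Ioo 0 b, A y ≤ 1 - y ^ 2 / 2 := fun y hy => by
    have := (h.mono hy.2.le).A_le hy.1 (k := 1 / 2)
      fun z hz => hW z ⟨hz.1.le, hz.2.le.trans hy.2.le⟩
    linarith
  have hanti : AntitoneOn W (Icc 0 b) := by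
    refine antitoneOn_of_deriv_nonpos (convex_Icc 0 b) h.cont_W ?_ ?_ <;> rw [interior_Icc]
    · exact fun y hy => (h.deriv_W y
        (Ioo_subset_Ioc_self hy)).differentiableAt.differentiableWithinAt
    · intro y hy
      have hy' := Ioo_subset_Ioc_self hy
      have hy'' := Ioo_subset_Icc_self hy
      rw [(h.deriv_W y hy').deriv]
      refine div_nonpos_of_nonpos_of_nonneg ?_ (mul_pos hy.1 (h.pos_A y hy')).le
      refine mul_nonpos_of_nonneg_of_nonpos (h.pos_W y hy'').le ?_
      nlinarith [hA y hy, mul_le_mul_of_nonneg_left (hW y hy'') (sq_nonneg y)]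
  refine strictAntiOn_of_deriv_neg (convex_Icc 0 b) h.cont_W ?_
  rw [interior_Icc]
  intro y hy
  have hy' := Ioo_subset_Ioc_self hy
  have hy'' := Ioo_subset_Icc_self hy
  rw [(h.deriv_W y hy').deriv]
  refine div_neg_of_neg_of_pos ?_ (mul_pos hy.1 (h.pos_A y hy'))
  refine mul_neg_of_pos_of_neg (h.pos_W y hy'') ?_
  have hlt : 1 / 2 < W y := hWb.trans_le (hanti hy'' (right_mem_Icc.2 hb.le) hy.2.le)
  nlinarith [hA y hy, mul_lt_mul_of_pos_left hlt (pow_pos hy.1 2)]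

/-- While `W ≥ 1/2`, the quantity `A W⁷` does not increase. -/
theorem antitoneOn_A_mul_W_pow (h : ReducedOrbit A W b) {c : ℝ} (hc : 0 ≤ c)
    (hW : ∀ y ∈ Ioo c b, 1 / 2 ≤ W y) : AntitoneOn (fun y => A y * W y ^ 7) (Icc c b) := by
  have hd : ∀ y ∈ Ioo c b, HasDerivAt (fun y => A y * W y ^ 7)
      (W y ^ 7 * (6 * (A y - 1 + y ^ 2 - y ^ 2 * W y) - 2 * (y ^ 2 * W y)) / y) y := by
    intro y hy
    have hy' : y ∈ Ioc 0 b := ⟨hc.trans_lt hy.1, hy.2.le⟩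
    have hne : y ≠ 0 := hy'.1.ne'
    have hA := (h.pos_A y hy').ne'
    refine ((h.deriv_A y hy').mul ((h.deriv_W y hy').pow 7)).congr_deriv ?_
    simp only [Pi.pow_apply]
    field_simp
    norm_num
    ring
  refine antitoneOn_of_deriv_nonpos (convex_Icc c b) ?_ ?_ ?_
  · exact (h.cont_A.mul (h.cont_W.pow 7)).mono (Icc_subset_Icc_left hc)
  · rw [interior_Icc]
    exact fun y hy => (hd y hy).differentiableAt.differentiableWithinAt
  · rw [interior_Icc]
    intro y hy
    have hy0 : 0 < y := hc.trans_lt hy.1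
    rw [(hd y hy).deriv]
    refine div_nonpos_of_nonpos_of_nonneg ?_ hy0.le
    refine mul_nonpos_of_nonneg_of_nonpos (pow_pos (h.pos_W y ⟨hy0.le, hy.2.le⟩) 7).le ?_
    have hA := (h.mono hy.2.le).A_le hy0 (k := 0)
      fun z hz => (h.pos_W z ⟨hz.1.le, hz.2.le.trans hy.2.le⟩).le
    nlinarith [mul_le_mul_of_nonneg_left (hW y hy) (sq_nonneg y)]

/-- At a point where `y² W` first reaches `1`, its derivative is nonnegative. -/
theorem A_ge_of_first_hit (h : ReducedOrbit A W b) (hb : 0 < b)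
    (hlt : ∀ y ∈ Ioo 0 b, y ^ 2 * W y < 1) (hq : 1 ≤ b ^ 2 * W b) :
    1 + b ^ 2 * W b - b ^ 2 ≤ 3 * A b := by
  have hbm : b ∈ Ioc 0 b := right_mem_Ioc.2 hb
  have hA := h.pos_A b hbm
  have hWb := h.pos_W b (Ioc_subset_Icc_self hbm)
  have hd : HasDerivAt (fun y => y ^ 2 * W y)
      (b * W b * (3 * A b - (1 + b ^ 2 * W b - b ^ 2)) / A b) b := by
    refine ((hasDerivAt_pow 2 b).mul (h.deriv_W b hbm)).congr_deriv ?_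
    have hne := hb.ne'
    have hne' := hA.ne'
    field_simp
    norm_num
    ring
  have ht := (hasDerivAt_iff_tendsto_slope.1 hd).mono_left
    (nhdsWithin_mono b fun y (hy : y ∈ Iio b) => hy.ne)
  have hnn : 0 ≤ b * W b * (3 * A b - (1 + b ^ 2 * W b - b ^ 2)) / A b := by
    refine ge_of_tendsto ht ?_
    filter_upwards [Ioo_mem_nhdsLT hb] with y hy
    rw [slope_def_field]
    exact div_nonneg_of_nonpos (by linarith [hlt y hy]) (by linarith [hy.2])
  by_contra! hcon
  exact hnn.not_gt (div_neg_of_neg_of_pos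
    (mul_neg_of_pos_of_neg (mul_pos hb hWb) (by linarith)) hA)

theorem sq_mul_W_lt_one_of_forall_lt (h : ReducedOrbit A W b) (hb : 0 < b)
    (hb2 : b ^ 2 ≤ 3 / 2) (hW0 : 1 < W 0) (hlt : ∀ y ∈ Ioo 0 b, y ^ 2 * W y < 1) :
    b ^ 2 * W b < 1 := by
  by_contra! hq
  have hA := h.A_ge_of_first_hit hb hlt hq
  have hb0 : 0 < b ^ 2 := pow_pos hb 2
  have hbI : b ∈ Icc 0 b := right_mem_Icc.2 hb.le
  have hWb : 2 / 3 ≤ W b := by nlinarith [h.pos_W b hbI]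
  by_cases hW : ∀ y ∈ Icc 0 b, 1 / 2 ≤ W y
  · have hanti := h.strictAntiOn_W hb hW (by linarith)
    have := h.A_lt hb (k := W b) fun y hy => hanti (Ioo_subset_Icc_self hy) hbI hy.2
    linarith
  · push Not at hW
    obtain ⟨z, hz, hWz⟩ := hW
    have hcomp : IsCompact (Icc 0 b ∩ W ⁻¹' Iic (1 / 2)) :=
      isCompact_Icc.of_isClosed_subset
        (h.cont_W.preimage_isClosed_of_isClosed isClosed_Icc isClosed_Iic) inter_subset_left
    obtain ⟨c, ⟨hc, hWc⟩, hmax⟩ := hcomp.exists_isGreatest ⟨z, hz, hWz.le⟩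
    have hWc' : W c ≤ 1 / 2 := hWc
    have hc0 : 0 < c := hc.1.lt_of_ne fun hc0 => by rw [← hc0] at hWc'; linarith
    have hanti := h.antitoneOn_A_mul_W_pow hc.1 fun y hy => by
      by_contra! hy'
      exact hy.1.not_ge (hmax ⟨⟨hc.1.trans hy.1.le, hy.2.le⟩, hy'.le⟩)
    have hle := hanti (left_mem_Icc.2 hc.2) (right_mem_Icc.2 hc.2) hc.2
    have hAc : A c ≤ 1 := by
      have := (h.mono hc.2).A_le hc0 (k := 0)
        fun y hy => (h.pos_W y ⟨hy.1.le, hy.2.le.trans hc.2⟩).le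
      nlinarith [sq_nonneg c]
    have hsmall : A c * W c ^ 7 ≤ 1 * (1 / 2) ^ 7 :=
      mul_le_mul hAc (pow_le_pow_left₀ (h.pos_W c hc).le hWc' 7)
        (pow_pos (h.pos_W c hc) 7).le zero_le_one
    have hlarge : 1 / 6 * (2 / 3) ^ 7 ≤ A b * W b ^ 7 :=
      mul_le_mul (by linarith) (pow_le_pow_left₀ (by norm_num) hWb 7) (by positivity)
        (h.pos_A b (right_mem_Ioc.2 hb)).le
    norm_num at hsmall hlarge hle
    linarith

theorem sq_mul_W_lt_one (h : ReducedOrbit A W b) (hb : 0 ≤ b) (hb2 : b ^ 2 ≤ 3 / 2)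
    (hW0 : 1 < W 0) : b ^ 2 * W b < 1 := by
  by_contra! hq
  have hcont : ContinuousOn (fun y => y ^ 2 * W y) (Icc 0 b) := by
    have := h.cont_W
    fun_prop
  have hcomp : IsCompact (Icc 0 b ∩ (fun y => y ^ 2 * W y) ⁻¹' Ici 1) :=
    isCompact_Icc.of_isClosed_subset
      (hcont.preimage_isClosed_of_isClosed isClosed_Icc isClosed_Ici) inter_subset_left
  obtain ⟨c, ⟨hc, hqc⟩, hmin⟩ := hcomp.exists_isLeast ⟨b, right_mem_Icc.2 hb, hq⟩
  have hqc' : 1 ≤ c ^ 2 * W c := hqc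
  have hc0 : 0 < c := hc.1.lt_of_ne fun hc0 => by
    rw [← hc0] at hqc'
    norm_num at hqc'
  refine hqc'.not_gt ((h.mono hc.2).sq_mul_W_lt_one_of_forall_lt hc0
    ((pow_le_pow_left₀ hc.1 hc.2 2).trans hb2) hW0 fun y hy => ?_)
  by_contra! hy'
  exact hy.2.not_ge (hmin ⟨⟨hy.1.le, hy.2.le.trans hc.2⟩, hy'⟩)

end ReducedOrbit

theorem IsLimitOrbit.reducedOrbit {A C : ℝ → ℝ} {α ybar b : ℝ} (hα : 0 < α)
    (h : IsLimitOrbit A C α (Ico 0 ybar)) (hb : b < ybar) :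
    ReducedOrbit A (fun y => A y * C y ^ 2) b := by
  obtain ⟨-, hsys, hA0, hC0, hA, hC⟩ := h
  have hmem : ∀ y ∈ Ioc 0 b, y ∈ Ico 0 ybar \ {0} := fun y hy =>
    ⟨⟨hy.1.le, hy.2.trans_lt hb⟩, hy.1.ne'⟩
  have hsub : Icc 0 b ⊆ Ico 0 ybar := fun y hy => ⟨hy.1, hy.2.trans_lt hb⟩
  have hcA : ContinuousOn A (Icc 0 b) := fun y hy => by
    rcases hy.1.eq_or_lt with rfl | hy0
    · exact hA0.mono hsub
    · exact (hsys y (hmem y ⟨hy0, hy.2⟩)).2.2.2.1.continuousAt.continuousWithinAt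
  have hcC : ContinuousOn C (Icc 0 b) := fun y hy => by
    rcases hy.1.eq_or_lt with rfl | hy0
    · exact hC0.mono hsub
    · exact (hsys y (hmem y ⟨hy0, hy.2⟩)).2.2.2.2.1.continuousAt.continuousWithinAt
  refine ⟨fun y hy => (hsys y (hmem y hy)).2.1, fun y hy => ?_, hA, hcA, hcA.mul (hcC.pow 2),
    fun y hy => ?_, fun y hy => ?_⟩
  · rcases hy.1.eq_or_lt with rfl | hy0
    · simp only [hA, hC]
      positivity
    · obtain ⟨-, hAy, hCy, -⟩ := hsys y (hmem y ⟨hy0, hy.2⟩)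
      positivity
  · obtain ⟨hy0, hAy, hCy, hdA, hdC, heA, heC⟩ := hsys y (hmem y hy)
    refine hdA.hasDerivAt.congr_deriv ?_
    rw [heA]
    field_simp
    ring
  · obtain ⟨hy0, hAy, hCy, hdA, hdC, heA, heC⟩ := hsys y (hmem y hy)
    refine (hdA.hasDerivAt.mul (hdC.hasDerivAt.pow 2)).congr_deriv ?_
    rw [heA, heC]
    simp only [Pi.pow_apply]
    field_simp
    norm_num
    ring

/-- For a solution of the limiting system on `[0, ȳ)` with `g = 1 − A C²`, the
function `p y = 1 + y² g y − y²` is positive at every point of the domain with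
`y² ≤ 3/2`. -/
theorem limit_p_positive (α : ℝ) (hα : 1 < α) (A C : ℝ → ℝ) (ybar : ℝ)
    (hybar : 0 < ybar) (horbit : IsLimitOrbit A C α (Set.Ico 0 ybar)) :
    ∀ y ∈ Set.Ico (0 : ℝ) ybar, y ^ 2 ≤ 3 / 2 →
      0 < 1 + y ^ 2 * (1 - A y * C y ^ 2) - y ^ 2 := by
  intro y hy hy2
  have hW0 : 1 < A 0 * C 0 ^ 2 := by
    obtain ⟨-, -, -, -, hA, hC⟩ := horbit
    rw [hA, hC]
    nlinarith
  have := (horbit.reducedOrbit (zero_lt_one.trans hα) hy.2).sq_mul_W_lt_one hy.1 hy2 hW0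
  linarith
end
end
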